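/- There exists N such that for every odd integer k > 5 and every integer n ≥ N with n not congruent to 4 (mod 7), the number of isomorphism classes of cyclic (K_{2nk+1}, C_k)-designs satisfies NC(2nk+1, k) ≥ 2.49^n / k. -/

import Mathlib

namespace CCS

/-- A block: a set of edges of the complete graph on `ZMod v`. -/
abbrev Block (v : ℕ) := Finset (Sym2 (ZMod v))

/-- The edge set of the closed tuple `c = (c 0, c 1, …, c (k-1))`. -/
def edgesOf {v k : ℕ} (c : Fin k → ZMod v) : Block v :=
  Finset.image (fun i : Fin k => s(c i, c ⟨(i.1 + 1) % k, Nat.mod_lt _ i.pos⟩)) Finset.univ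

/-- `E` is the edge set of a `k`-cycle on `ZMod v`. Since for `k ≥ 3` the edge set
determines the closed tuple up to rotation and reversal, a `k`-cycle is identified
with its edge set. -/
def IsCycleBlock (v k : ℕ) (E : Block v) : Prop :=
  ∃ c : Fin k → ZMod v, Function.Injective c ∧ E = edgesOf c

/-- The translate `E + z` of a cycle. -/
def translateBlock {v : ℕ} (E : Block v) (z : ZMod v) : Block v :=
  E.image (Sym2.map (· + z))

/-- A `(K_v, C_k)`-design: a set of `k`-cycles whose edge sets partition the edges of `K_v`. -/
def IsDesign (v k : ℕ) (B : Set (Block v)) : Prop :=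
  (∀ E ∈ B, IsCycleBlock v k E) ∧
  ∀ e : Sym2 (ZMod v), ¬ e.IsDiag → ∃! E, E ∈ B ∧ e ∈ E

/-- A cyclic `(K_v, C_k)`-design. -/
def IsCyclicDesign (v k : ℕ) (B : Set (Block v)) : Prop :=
  IsDesign v k B ∧ ∀ E ∈ B, ∀ z : ZMod v, translateBlock E z ∈ B

/-- Two designs are isomorphic if a bijection of `ZMod v` maps one onto the other. -/
def Isomorphic {v : ℕ} (B B' : Set (Block v)) : Prop :=
  ∃ f : ZMod v ≃ ZMod v, B' = (fun E : Block v => E.image (Sym2.map f)) '' B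

/-- `NC v k`: the number of cyclic `(K_v, C_k)`-designs up to isomorphism. -/
noncomputable def NC (v k : ℕ) : ℕ :=
  Nat.card (Quot fun B B' : {B : Set (Block v) // IsCyclicDesign v k B} =>
    Isomorphic B.1 B'.1)

/-- The type of a cycle: the order of its stabilizer under translations. -/
noncomputable def cycleType {v : ℕ} (E : Block v) : ℕ :=
  Nat.card {z : ZMod v // translateBlock E z = E}

/-- The two differences `±(a-b)` arising from an edge `{a,b}`. -/
def edgeDiffs {v : ℕ} : Sym2 (ZMod v) → Multiset (ZMod v) :=
  Sym2.lift ⟨fun a b => {a - b, b - a}, fun a b => by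
    show (a-b) ::ₘ {b-a} = (b-a) ::ₘ {a-b}; exact Multiset.cons_swap _ _ _⟩

/-- The multiset of the `2k` differences arising from the `k` edges of a cycle.
For a cycle of type `d` this is `d` copies of the list `∂C` of partial differences. -/
def fullDiffs {v : ℕ} (E : Block v) : Multiset (ZMod v) :=
  E.val.bind edgeDiffs

/-- The multiset `∂C` of partial differences of a cycle: each difference is counted
with multiplicity equal to its multiplicity among the `2k` edge differences divided
by the type of the cycle. -/
noncomputable def partialDiffs {v : ℕ} (E : Block v) : Multiset (ZMod v) :=
  (fullDiffs E).toFinset.val.bind fun x =>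
    Multiset.replicate ((fullDiffs E).count x / cycleType E) x

/-- A `(K_v, C_k)`-difference system: a set of `k`-cycles whose partial differences
cover every nonzero element of `ZMod v` exactly once. -/
def IsDifferenceSystem (v k : ℕ) (F : Finset (Block v)) : Prop :=
  (∀ E ∈ F, IsCycleBlock v k E) ∧
  ∀ x : ZMod v, (F.val.bind partialDiffs).count x = if x = 0 then 0 else 1

end CCS

namespace CCS

theorem Isomorphic.refl {v : ℕ} (B : Set (Block v)) : Isomorphic B B := by
  refine ⟨Equiv.refl _, ?_⟩
  have : (fun E : Block v => E.image (Sym2.map (Equiv.refl (ZMod v)))) = id := by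
    funext E
    simp
  rw [this, Set.image_id]

theorem image_image_sym2 {v : ℕ} (f g : ZMod v ≃ ZMod v) (B : Set (Block v)) :
    (fun E : Block v => E.image (Sym2.map g)) '' ((fun E : Block v => E.image (Sym2.map f)) '' B) =
      (fun E : Block v => E.image (Sym2.map (f.trans g))) '' B := by
  rw [Set.image_image]
  congr 1
  funext E
  rw [Finset.image_image, ← Sym2.map_comp]
  rfl

theorem image_refl_sym2 {v : ℕ} (B : Set (Block v)) :
    (fun E : Block v => E.image (Sym2.map (Equiv.refl (ZMod v)))) '' B = B := by
  have : (fun E : Block v => E.image (Sym2.map (Equiv.refl (ZMod v)))) = id := by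
    funext E
    simp
  rw [this, Set.image_id]

theorem Isomorphic.symm {v : ℕ} {B B' : Set (Block v)} (h : Isomorphic B B') :
    Isomorphic B' B := by
  obtain ⟨f, rfl⟩ := h
  exact ⟨f.symm, by rw [image_image_sym2, Equiv.self_trans_symm, image_refl_sym2]⟩

theorem Isomorphic.trans {v : ℕ} {B B' B'' : Set (Block v)} (h : Isomorphic B B')
    (h' : Isomorphic B' B'') : Isomorphic B B'' := by
  obtain ⟨f, rfl⟩ := h
  obtain ⟨g, rfl⟩ := h'
  exact ⟨f.trans g, image_image_sym2 f g B⟩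

/-- The image of a set of blocks under a permutation of the points. -/
def mapBlocks {v : ℕ} (f : Equiv.Perm (ZMod v)) (B : Set (Block v)) : Set (Block v) :=
  (fun E : Block v => E.image (Sym2.map f)) '' B

theorem mapBlocks_mul {v : ℕ} (f g : Equiv.Perm (ZMod v)) (B : Set (Block v)) :
    mapBlocks (f * g) B = mapBlocks f (mapBlocks g B) :=
  (image_image_sym2 g f B).symm

theorem mapBlocks_one {v : ℕ} (B : Set (Block v)) : mapBlocks 1 B = B :=
  image_refl_sym2 B

theorem mapBlocks_addRight {v k : ℕ} {B : Set (Block v)} (hB : IsCyclicDesign v k B) (z : ZMod v) :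
    mapBlocks (Equiv.addRight z) B = B := by
  have sub : ∀ z : ZMod v, mapBlocks (Equiv.addRight z) B ⊆ B := by
    rintro z _ ⟨E, hE, rfl⟩
    exact hB.2 E hE z
  refine (sub z).antisymm fun E hE => ?_
  have h := mapBlocks_mul (Equiv.addRight z) (Equiv.addRight (-z)) B
  have h1 : Equiv.addRight z * Equiv.addRight (-z) = (1 : Equiv.Perm (ZMod v)) := by
    ext x
    simp
  rw [h1, mapBlocks_one] at h
  rw [h] at hE
  exact Set.image_mono (sub (-z)) hE

/-- An isomorphism class contains at most `v` cyclic designs. -/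
theorem card_isomorphic_le {v k : ℕ} [NeZero v] (B : Set (Block v)) :
    Nat.card {B' : {B : Set (Block v) // IsCyclicDesign v k B} // Isomorphic B B'.1} ≤ v := by
  classical
  let A := {g : Equiv.Perm (ZMod v) // mapBlocks g B = B}
  let S := {B' : {B : Set (Block v) // IsCyclicDesign v k B} // Isomorphic B B'.1}
  have : Nonempty A := ⟨⟨1, mapBlocks_one B⟩⟩
  have hf : ∀ s : S, ∃ f : Equiv.Perm (ZMod v), s.1.1 = mapBlocks f B := fun s => s.2
  choose f hf using hf
  have cancel : ∀ (g : Equiv.Perm (ZMod v)) {X Y : Set (Block v)}, X = mapBlocks g Y →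
      mapBlocks g⁻¹ X = Y := by
    rintro g X Y rfl
    rw [← mapBlocks_mul, inv_mul_cancel, mapBlocks_one]
  let F : S × A → Equiv.Perm (ZMod v) := fun x => f x.1 * x.2.1
  have hF : ∀ x, mapBlocks (F x) B = x.1.1.1 := by
    intro x
    rw [mapBlocks_mul, x.2.2, hf]
  let Φ : S × A → A × ZMod v := fun x =>
    (⟨(F x)⁻¹ * Equiv.addRight 1 * F x, by
      rw [mapBlocks_mul, mapBlocks_mul, hF, mapBlocks_addRight x.1.1.2]
      exact cancel _ (hF x).symm⟩, (F x)⁻¹ 0)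
  have hΦ : Function.Injective Φ := by
    intro x y hxy
    obtain ⟨h1, h2⟩ := Prod.ext_iff.1 hxy
    replace h1 : (F x)⁻¹ * Equiv.addRight 1 * F x = (F y)⁻¹ * Equiv.addRight 1 * F y :=
      congrArg Subtype.val h1
    replace h2 : (F x)⁻¹ 0 = (F y)⁻¹ 0 := h2
    have step : ∀ z : ZMod v, (F x)⁻¹ z = (F y)⁻¹ z → (F x)⁻¹ (z + 1) = (F y)⁻¹ (z + 1) := by
      intro z hz
      have h3 := congrArg (fun g : Equiv.Perm (ZMod v) => g ((F x)⁻¹ z)) h1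
      have key : ∀ g : Equiv.Perm (ZMod v), g (g⁻¹ z) = z := fun g => g.apply_symm_apply z
      simp only [Equiv.Perm.mul_apply, key, Equiv.coe_addRight] at h3
      rw [hz, key] at h3
      exact h3
    have all : ∀ m : ℕ, (F x)⁻¹ (m : ZMod v) = (F y)⁻¹ (m : ZMod v) := by
      intro m
      induction m with
      | zero => simpa using h2
      | succ m ih => simpa using step _ ih
    have hFF : F x = F y := by
      rw [← inv_inj]
      ext z
      rw [← ZMod.natCast_zmod_val z, all]
    have hs : x.1 = y.1 := by
      apply Subtype.ext
      apply Subtype.ext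
      rw [← hF, ← hF, hFF]
    refine Prod.ext hs (Subtype.ext ?_)
    have : f x.1 * x.2.1 = f y.1 * y.2.1 := hFF
    rw [hs] at this
    exact mul_left_cancel this
  have := Nat.card_le_card_of_injective Φ hΦ
  rw [Nat.card_prod, Nat.card_prod, Nat.card_zmod, mul_comm] at this
  exact Nat.le_of_mul_le_mul_left this Nat.card_pos

theorem card_cyclicDesign_le (v k : ℕ) [NeZero v] :
    Nat.card {B : Set (Block v) // IsCyclicDesign v k B} ≤ NC v k * v := by
  classical
  let D := {B : Set (Block v) // IsCyclicDesign v k B}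
  let r : D → D → Prop := fun B B' => Isomorphic B.1 B'.1
  have hr : Equivalence r := ⟨fun B => .refl _, fun h => h.symm, fun h h' => h.trans h'⟩
  let π : D → Quot r := Quot.mk r
  have e : D ≃ Σ q : Quot r, {B : D // π B = q} := (Equiv.sigmaFiberEquiv π).symm
  have : Fintype (Quot r) := Fintype.ofFinite _
  rw [show Nat.card D = _ from Nat.card_congr e, Nat.card_sigma]
  have hle : ∀ q : Quot r, Nat.card {B : D // π B = q} ≤ v := by
    intro q
    obtain ⟨B, rfl⟩ := Quot.exists_rep q
    refine le_trans (Nat.card_congr (Equiv.subtypeEquivRight fun B' => ?_)).le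
      (card_isomorphic_le (k := k) B.1)
    constructor
    · intro h
      exact (hr.quot_mk_eq_iff _ _).1 h.symm
    · intro h
      exact Quot.sound (r := r) (Isomorphic.symm h)
  calc ∑ q, Nat.card {B : D // π B = q} ≤ ∑ _q : Quot r, v := Finset.sum_le_sum fun q _ => hle q
    _ = NC v k * v := by
      rw [Finset.sum_const, Finset.card_univ, smul_eq_mul, ← Nat.card_eq_fintype_card]
      rfl

/-- The block of the closed walk `f 0, f 1, …, f k = f 0`. -/
def walkBlock {v : ℕ} (k : ℕ) (f : ℕ → ZMod v) : Block v :=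
  edgesOf fun j : Fin k => f j

theorem mem_walkBlock {v k : ℕ} {f : ℕ → ZMod v} (hf : f k = f 0) {e : Sym2 (ZMod v)} :
    e ∈ walkBlock k f ↔ ∃ m < k, e = s(f m, f (m + 1)) := by
  have succ : ∀ m < k, f ((m + 1) % k) = f (m + 1) := by
    intro m hm
    rcases Nat.lt_or_ge (m + 1) k with h | h
    · rw [Nat.mod_eq_of_lt h]
    · obtain rfl : k = m + 1 := by omega
      rw [Nat.mod_self, hf]
  simp only [walkBlock, edgesOf, Finset.mem_image, Finset.mem_univ, true_and]
  constructor
  · rintro ⟨⟨m, hm⟩, rfl⟩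
    exact ⟨m, hm, by rw [← succ m hm]⟩
  · rintro ⟨m, hm, rfl⟩
    exact ⟨⟨m, hm⟩, by rw [← succ m hm]⟩

theorem mem_translate_walkBlock {v k : ℕ} {f : ℕ → ZMod v} (hf : f k = f 0) {z : ZMod v}
    {e : Sym2 (ZMod v)} :
    e ∈ translateBlock (walkBlock k f) z ↔ ∃ m < k, e = s(f m + z, f (m + 1) + z) := by
  simp only [translateBlock, Finset.mem_image, mem_walkBlock hf]
  constructor
  · rintro ⟨_, ⟨m, hm, rfl⟩, rfl⟩
    exact ⟨m, hm, rfl⟩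
  · rintro ⟨m, hm, rfl⟩
    exact ⟨_, ⟨m, hm, rfl⟩, rfl⟩

theorem translateBlock_translateBlock {v : ℕ} (E : Block v) (y z : ZMod v) :
    translateBlock (translateBlock E y) z = translateBlock E (y + z) := by
  rw [translateBlock, translateBlock, Finset.image_image, ← Sym2.map_comp, translateBlock]
  congr 2
  funext x
  simp [add_assoc]

theorem translateBlock_zero {v : ℕ} (E : Block v) : translateBlock E 0 = E := by
  simp [translateBlock]

/-- Closed walks `C i` whose signed differences cover all nonzero elements of `ZMod v`. -/
structure IsDiffFamily {v : ℕ} (n k : ℕ) (C : Fin n → ℕ → ZMod v) : Prop where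
  closed : ∀ i, C i k = C i 0
  inj : ∀ i, ∀ a < k, ∀ b < k, C i a = C i b → a = b
  cover : ∀ x : ZMod v, x ≠ 0 →
    ∃ i, ∃ m < k, C i (m + 1) - C i m = x ∨ C i m - C i (m + 1) = x

/-- The signed differences along the walks. -/
def signedDiff {v n k : ℕ} (C : Fin n → ℕ → ZMod v) (x : Fin n × Fin k × Bool) : ZMod v :=
  if x.2.2 then C x.1 (x.2.1 + 1) - C x.1 x.2.1 else C x.1 x.2.1 - C x.1 (x.2.1 + 1)

/-- The translates of the walks of a family. -/
def developed {v n : ℕ} (k : ℕ) (C : Fin n → ℕ → ZMod v) : Set (Block v) :=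
  {E | ∃ i z, E = translateBlock (walkBlock k (C i)) z}

namespace IsDiffFamily

variable {n k : ℕ} {C : Fin n → ℕ → ZMod (2 * n * k + 1)}

theorem signedDiff_injective (h : IsDiffFamily n k C) :
    Function.Injective (signedDiff (k := k) C) := by
  classical
  have hsub : (Finset.univ.erase (0 : ZMod (2 * n * k + 1))) ⊆
      Finset.univ.image (signedDiff (k := k) C) := by
    intro x hx
    obtain ⟨i, m, hm, hx'⟩ := h.cover x (Finset.ne_of_mem_erase hx)
    rw [Finset.mem_image]
    rcases hx' with hx' | hx'
    · exact ⟨(i, ⟨m, hm⟩, true), Finset.mem_univ _, by simpa [signedDiff] using hx'⟩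
    · exact ⟨(i, ⟨m, hm⟩, false), Finset.mem_univ _, by simpa [signedDiff] using hx'⟩
  have hcard := Finset.card_le_card hsub
  rw [Finset.card_erase_of_mem (Finset.mem_univ _), Finset.card_univ, ZMod.card] at hcard
  have hle := Finset.card_image_le (s := (Finset.univ : Finset (Fin n × Fin k × Bool)))
    (f := signedDiff (k := k) C)
  have huniv : (Finset.univ : Finset (Fin n × Fin k × Bool)).card = 2 * n * k := by
    simp only [Finset.card_univ, Fintype.card_prod, Fintype.card_fin, Fintype.card_bool]
    ring
  have := Finset.card_image_iff.1 (le_antisymm hle (by omega))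
  exact fun x y hxy => this (Finset.mem_coe.2 (Finset.mem_univ x))
    (Finset.mem_coe.2 (Finset.mem_univ y)) hxy

theorem diff_eq (h : IsDiffFamily n k C) {i j : Fin n} {a b : ℕ} (ha : a < k) (hb : b < k)
    (hab : C i (a + 1) - C i a = C j (b + 1) - C j b) : i = j ∧ a = b := by
  have := @signedDiff_injective n k C h (i, ⟨a, ha⟩, true) (j, ⟨b, hb⟩, true)
    (by simpa [signedDiff] using hab)
  simpa using this

theorem diff_ne_neg (h : IsDiffFamily n k C) {i j : Fin n} {a b : ℕ} (ha : a < k) (hb : b < k) :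
    C i (a + 1) - C i a ≠ C j b - C j (b + 1) := by
  intro hab
  have := @signedDiff_injective n k C h (i, ⟨a, ha⟩, true) (j, ⟨b, hb⟩, false)
    (by simpa [signedDiff] using hab)
  simp at this

/-- The edge with a given difference determines the walk and the translation. -/
theorem eq_of_mem_translate (h : IsDiffFamily n k C) {i j : Fin n} {a : ℕ} (ha : a < k)
    {u z : ZMod (2 * n * k + 1)}
    (hu : s(u, u + (C i (a + 1) - C i a)) ∈ translateBlock (walkBlock k (C j)) z) :
    j = i ∧ u = C i a + z := by
  obtain ⟨b, hb, hu⟩ := (mem_translate_walkBlock (h.closed j)).1 hu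
  rcases Sym2.eq_iff.1 hu with ⟨h1, h2⟩ | ⟨h1, h2⟩
  · have hd : C i (a + 1) - C i a = C j (b + 1) - C j b := by
      rw [h1] at h2
      linear_combination h2
    obtain ⟨rfl, rfl⟩ := h.diff_eq ha hb hd
    exact ⟨rfl, h1⟩
  · refine absurd ?_ (h.diff_ne_neg ha hb (i := i) (j := j))
    rw [h1] at h2
    linear_combination h2

theorem mem_translate (h : IsDiffFamily n k C) {i : Fin n} {a : ℕ} (ha : a < k)
    (z : ZMod (2 * n * k + 1)) :
    s(C i a + z, C i a + z + (C i (a + 1) - C i a)) ∈ translateBlock (walkBlock k (C i)) z := by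
  refine (mem_translate_walkBlock (h.closed i)).2 ⟨a, ha, ?_⟩
  congr 1
  ring_nf

theorem isCyclicDesign (h : IsDiffFamily n k C) :
    IsCyclicDesign (2 * n * k + 1) k (developed k C) := by
  refine ⟨⟨?_, ?_⟩, ?_⟩
  · rintro _ ⟨i, z, rfl⟩
    refine ⟨fun j => C i j + z, fun a b hab => ?_, ?_⟩
    · exact Fin.ext (h.inj i a a.2 b b.2 (add_right_cancel hab))
    · rw [translateBlock, walkBlock, edgesOf, edgesOf, Finset.image_image]
      rfl
  · intro e he
    have main : ∀ (i : Fin n) (m : ℕ), m < k → ∀ u : ZMod (2 * n * k + 1),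
        ∃! E, E ∈ developed k C ∧ s(u, u + (C i (m + 1) - C i m)) ∈ E := by
      intro i m hm u
      refine ⟨translateBlock (walkBlock k (C i)) (u - C i m), ⟨⟨i, _, rfl⟩, ?_⟩, ?_⟩
      · have := h.mem_translate hm (i := i) (u - C i m)
        rwa [add_sub_cancel] at this
      · rintro _ ⟨⟨j, z, rfl⟩, hz⟩
        obtain ⟨rfl, rfl⟩ := h.eq_of_mem_translate hm hz
        rw [add_sub_cancel_left]
    induction e with
    | _ a b =>
      have hab : b - a ≠ 0 := by
        intro h0
        exact he (Sym2.mk_isDiag_iff.2 (sub_eq_zero.1 h0).symm)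
      obtain ⟨i, m, hm, hx | hx⟩ := h.cover _ hab
      · have := main i m hm a
        rwa [hx, add_sub_cancel] at this
      · have := main i m hm b
        rw [← neg_sub (C i m), hx, neg_sub, add_sub_cancel] at this
        rwa [Sym2.eq_swap]
  · rintro _ ⟨i, y, rfl⟩ z
    exact ⟨i, y + z, translateBlock_translateBlock _ _ _⟩

end IsDiffFamily

/-- Replacing the vertex `c m` by `reflected c m` exchanges the two differences at `m`. -/
def reflected {R : Type*} [AddCommGroup R] (c : ℕ → R) (m : ℕ) : R :=
  c (m - 1) + c (m + 1) - c m

/-- The walk `c` with its vertices at `p` and `q` optionally reflected. -/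
def switched {R : Type*} [AddCommGroup R] (p q : ℕ) (c : ℕ → R) (w : Bool × Bool) (m : ℕ) : R :=
  if m = p ∧ w.1 then reflected c p else if m = q ∧ w.2 then reflected c q else c m

/-- The first `k` vertices of `c` followed by the reflected vertices at `p` and `q`. -/
def extended {R : Type*} [AddCommGroup R] (k p q : ℕ) (c : ℕ → R) (m : ℕ) : R :=
  if m = k then reflected c p else if m = k + 1 then reflected c q else c m

/-- Walks in which the reflections at `p` and `q` are always possible, with signed differences
covering all nonzero elements of `ZMod v`. -/
structure IsSwitchable {v : ℕ} (n k p q : ℕ) (c : Fin n → ℕ → ZMod v) : Prop where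
  two_le : 2 ≤ p
  add_two_le : p + 2 ≤ q
  lt : q + 1 < k
  closed : ∀ i, c i k = c i 0
  inj : ∀ i, ∀ a < k + 2, ∀ b < k + 2, extended k p q (c i) a = extended k p q (c i) b → a = b
  cover : ∀ x : ZMod v, x ≠ 0 →
    ∃ i, ∃ m < k, c i (m + 1) - c i m = x ∨ c i m - c i (m + 1) = x

namespace IsSwitchable

variable {n k p q : ℕ} {c : Fin n → ℕ → ZMod (2 * n * k + 1)}

theorem isDiffFamily (h : IsSwitchable n k p q c) (φ : Fin n → Bool × Bool) :
    IsDiffFamily n k fun i => switched p q (c i) (φ i) := by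
  have h2 := h.two_le
  have h3 := h.add_two_le
  have h4 := h.lt
  refine ⟨fun i => ?_, fun i a ha b hb hab => ?_, fun x hx => ?_⟩
  · have e1 : ¬ k = p := by omega
    have e2 : ¬ k = q := by omega
    have e3 : ¬ 0 = p := by omega
    have e4 : ¬ 0 = q := by omega
    simp only [switched, e1, e2, e3, e4, false_and, if_false, h.closed]
  · have key : ∀ m < k, switched p q (c i) (φ i) m = extended k p q (c i)
        (if m = p ∧ (φ i).1 then k else if m = q ∧ (φ i).2 then k + 1 else m) := by
      intro m hm
      have e1 : ¬ m = k := by omega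
      have e2 : ¬ m = k + 1 := by omega
      have e3 : ¬ k + 1 = k := by omega
      unfold switched
      by_cases h5 : m = p ∧ (φ i).1
      · rw [if_pos h5, if_pos h5, extended, if_pos rfl]
      · rw [if_neg h5, if_neg h5]
        by_cases h6 : m = q ∧ (φ i).2
        · rw [if_pos h6, if_pos h6, extended, if_neg e3, if_pos rfl]
        · rw [if_neg h6, if_neg h6, extended, if_neg e1, if_neg e2]
    rw [key a ha, key b hb] at hab
    have := h.inj i _ (by split_ifs <;> omega) _ (by split_ifs <;> omega) hab
    split_ifs at this <;> omega
  · obtain ⟨i, m, hm, hx'⟩ := h.cover x hx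
    refine ⟨i, ?_⟩
    have off : ∀ m, (m = p → (φ i).1 = false) → (m = q → (φ i).2 = false) →
        switched p q (c i) (φ i) m = c i m := by
      intro m h5 h6
      unfold switched
      rw [if_neg, if_neg]
      · rintro ⟨h7, h8⟩
        simp [h6 h7] at h8
      · rintro ⟨h7, h8⟩
        simp [h5 h7] at h8
    have swap : ∀ r, 1 ≤ r → (r = p ∨ r = q) → r + 1 ≤ k →
        switched p q (c i) (φ i) r = reflected (c i) r → (m = r - 1 ∨ m = r) →
        ∃ m < k, switched p q (c i) (φ i) (m + 1) - switched p q (c i) (φ i) m = x ∨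
          switched p q (c i) (φ i) m - switched p q (c i) (φ i) (m + 1) = x := by
      intro r hr hpq hrk hrefl hmr
      have e1 : switched p q (c i) (φ i) (r - 1) = c i (r - 1) := by
        apply off <;> intro <;> omega
      have e2 : switched p q (c i) (φ i) (r + 1) = c i (r + 1) := by
        apply off <;> intro <;> omega
      have e3 : r - 1 + 1 = r := by omega
      rcases hmr with rfl | rfl
      · refine ⟨r, by omega, ?_⟩
        rw [e2, hrefl, reflected]
        rw [e3] at hx'
        refine hx'.imp (fun h => ?_) (fun h => ?_) <;> rw [← h] <;> abel
      · refine ⟨m - 1, by omega, ?_⟩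
        rw [e3, e1, hrefl, reflected]
        refine hx'.imp (fun h => ?_) (fun h => ?_) <;> rw [← h] <;> abel
    by_cases hp : (m = p - 1 ∨ m = p) ∧ (φ i).1 = true
    · exact swap p (by omega) (.inl rfl) (by omega) (by simp [switched, hp.2]) hp.1
    by_cases hq : (m = q - 1 ∨ m = q) ∧ (φ i).2 = true
    · refine swap q (by omega) (.inr rfl) (by omega) ?_ hq.1
      have : ¬ q = p := by omega
      simp [switched, hq.2, this]
    refine ⟨m, hm, ?_⟩
    rw [off m, off (m + 1)]
    · exact hx'
    · intro hm'
      by_contra h5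
      exact hp ⟨.inl (by omega), by simpa using h5⟩
    · intro hm'
      by_contra h5
      exact hq ⟨.inl (by omega), by simpa using h5⟩
    · intro hm'
      by_contra h5
      exact hp ⟨.inr (by omega), by simpa using h5⟩
    · intro hm'
      by_contra h5
      exact hq ⟨.inr (by omega), by simpa using h5⟩

/-- A translate of a walk does not contain two consecutive differences in exchanged order. -/
theorem _root_.CCS.IsDiffFamily.not_mem_swapped {C : Fin n → ℕ → ZMod (2 * n * k + 1)}
    (h : IsDiffFamily n k C) {i j : Fin n} {a : ℕ} (ha : a + 1 < k) {u z : ZMod (2 * n * k + 1)}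
    (h1 : s(u, u + (C i (a + 1 + 1) - C i (a + 1))) ∈ translateBlock (walkBlock k (C j)) z)
    (h2 : s(u + (C i (a + 1 + 1) - C i (a + 1)),
      u + (C i (a + 1 + 1) - C i (a + 1)) + (C i (a + 1) - C i a)) ∈
        translateBlock (walkBlock k (C j)) z) : False := by
  obtain ⟨rfl, h3⟩ := h.eq_of_mem_translate ha h1
  obtain ⟨-, h4⟩ := h.eq_of_mem_translate (Nat.lt_of_succ_lt ha) h2
  refine h.diff_ne_neg ha (Nat.lt_of_succ_lt ha) (i := j) (j := j) ?_
  rw [h3] at h4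
  linear_combination h4

theorem developed_injective (h : IsSwitchable n k p q c) :
    Function.Injective fun φ : Fin n → Bool × Bool =>
      developed k fun i => switched p q (c i) (φ i) := by
  have h2 := h.two_le
  have h3 := h.add_two_le
  have h4 := h.lt
  intro φ ψ hφψ
  funext i
  have hmem : walkBlock k (switched p q (c i) (φ i)) ∈
      developed k fun i => switched p q (c i) (φ i) :=
    ⟨i, 0, (translateBlock_zero _).symm⟩
  dsimp only at hφψ
  rw [hφψ] at hmem
  obtain ⟨j, z, hE⟩ := hmem
  have hD := h.isDiffFamily ψ
  have hD' := h.isDiffFamily φ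
  have edge : ∀ a < k, s(switched p q (c i) (φ i) a, switched p q (c i) (φ i) (a + 1)) ∈
      translateBlock (walkBlock k (switched p q (c j) (ψ j))) z := by
    intro a ha
    rw [← hE]
    exact (mem_walkBlock (hD'.closed i)).2 ⟨a, ha, rfl⟩
  have start : ∀ w, switched p q (c i) w 0 = c i 0 ∧ switched p q (c i) w 1 = c i 1 := by
    intro w
    have e1 : ¬ 0 = p := by omega
    have e2 : ¬ 0 = q := by omega
    have e3 : ¬ 1 = p := by omega
    have e4 : ¬ 1 = q := by omega
    simp only [switched, e1, e2, e3, e4, false_and, if_false, and_self]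
  have hji : j = i := by
    have h0 := edge 0 (by omega)
    rw [zero_add, (start (φ i)).1, (start (φ i)).2, ← add_sub_cancel (c i 0) (c i 1),
      ← (start (ψ i)).1, ← (start (ψ i)).2] at h0
    exact (hD.eq_of_mem_translate (i := i) (a := 0) (by omega) h0).1
  have noswap : ∀ r, 1 ≤ r → r + 1 ≤ k → ∀ w w' : Bool × Bool,
      switched p q (c i) w (r - 1) = switched p q (c i) w' (r - 1) →
      switched p q (c i) w (r + 1) = switched p q (c i) w' (r + 1) →
      switched p q (c i) w r = reflected (switched p q (c i) w') r → w = φ i → w' = ψ i →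
      False := by
    rintro r hr hrk _ _ e1 e2 e3 rfl rfl
    obtain ⟨a, rfl⟩ : ∃ a, r = a + 1 := ⟨r - 1, by omega⟩
    rw [reflected, Nat.add_sub_cancel] at e3
    rw [Nat.add_sub_cancel] at e1
    refine hD.not_mem_swapped (i := i) (j := j) (a := a) (z := z) (by omega)
      (u := switched p q (c i) (φ i) a) ?_ ?_
    · convert edge a (by omega) using 2
      rw [e3, e1]
      abel
    · convert edge (a + 1) (by omega) using 2
      · rw [e3, e1]
        abel
      · rw [e2, e1]
        abel
  have val : ∀ w r, r ≠ p → r ≠ q → switched p q (c i) w r = c i r := by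
    intro w r hp hq
    simp [switched, hp, hq]
  have hqp : ¬ q = p := by omega
  have valp : ∀ a b, switched p q (c i) (a, b) p = if a then reflected (c i) p else c i p := by
    have hpq : ¬ p = q := by omega
    intro a b
    simp [switched, hpq]
  have valq : ∀ a b, switched p q (c i) (a, b) q = if b then reflected (c i) q else c i q := by
    intro a b
    simp [switched, hqp]
  by_contra hne
  rcases hw : φ i with ⟨a, b⟩
  rcases hw' : ψ i with ⟨a', b'⟩
  by_cases haa : a = a'
  · have hbb : b ≠ b' := by
      rintro rfl
      exact hne (by rw [hw, hw', haa])
    refine noswap q (by omega) (by omega) (a, b) (a', b') ?_ ?_ ?_ hw.symm hw'.symm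
    · rw [val, val] <;> omega
    · rw [val, val] <;> omega
    · rw [reflected, val _ (q - 1) (by omega) (by omega), val _ (q + 1) (by omega) (by omega)]
      rw [valq, valq, reflected]
      cases b <;> cases b' <;> simp at hbb ⊢
  · refine noswap p (by omega) (by omega) (a, b) (a', b') ?_ ?_ ?_ hw.symm hw'.symm
    · rw [val, val] <;> omega
    · rw [val, val] <;> omega
    · rw [reflected, val _ (p - 1) (by omega) (by omega), val _ (p + 1) (by omega) (by omega)]
      rw [valp, valp, reflected]
      cases a <;> cases a' <;> simp at haa ⊢

theorem four_pow_le (h : IsSwitchable n k p q c) :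
    4 ^ n ≤ NC (2 * n * k + 1) k * (2 * n * k + 1) := by
  classical
  refine le_trans ?_ (card_cyclicDesign_le (2 * n * k + 1) k)
  have := Nat.card_le_card_of_injective
    (fun φ : Fin n → Bool × Bool =>
      (⟨_, (h.isDiffFamily φ).isCyclicDesign⟩ :
        {B : Set (Block (2 * n * k + 1)) // IsCyclicDesign (2 * n * k + 1) k B}))
    (fun φ ψ hφψ => h.developed_injective (congrArg Subtype.val hφψ))
  simpa using this

end IsSwitchable

/-- The numbers `D b` and `D b + b` for `1 ≤ b ≤ n` exhaust `1, …, 2 * n - 1` and `2 * n + h`,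
a Skolem sequence for `h = 0` and a hooked one for `h = 1`. -/
structure IsSkolem (n h : ℕ) (D : ℕ → ℕ) : Prop where
  pos : ∀ b, 1 ≤ b → b ≤ n → 1 ≤ D b
  add_le : ∀ b, 1 ≤ b → b ≤ n → D b + b ≤ 2 * n + h
  ne : ∀ b, 1 ≤ b → b ≤ n → D b ≠ 2 * n + h - 1 ∨ h = 0
  add_ne : ∀ b, 1 ≤ b → b ≤ n → D b + b ≠ 2 * n + h - 1 ∨ h = 0
  cover : ∀ d, 1 ≤ d → d < 2 * n ∨ d = 2 * n + h → ∃ b, 1 ≤ b ∧ b ≤ n ∧ (D b = d ∨ D b + b = d)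

theorem isSkolem_zero {s : ℕ} (hs : 3 ≤ s) : IsSkolem (4 * s) 0 fun b =>
    if b % 2 = 0 then 6 * s - b / 2 else if b = 1 then s else if b + 1 = 2 * s then 2 * s
      else if b = 2 * s + 1 then s - 1 else if b + 1 = 4 * s then 2 * s + 1
      else if b < 2 * s then s + 1 + (2 * s - 1 - b) / 2 else (4 * s - 1 - b) / 2 := by
  refine ⟨?_, ?_, ?_, ?_, fun d hd hd' => ?_⟩
  iterate 4
    intro b hb hb'
    split_ifs <;> omega
  have cases :
    (d = s - 1 ∨ d = 3 * s) ∨ (d = s ∨ d = s + 1) ∨ (d = 2 * s ∨ d = 4 * s - 1) ∨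
      (d = 2 * s + 1 ∨ d = 6 * s) ∨ d + 2 ≤ s ∨ (s + 2 ≤ d ∧ d < 2 * s) ∨
      (2 * s + 2 ≤ d ∧ d < 3 * s) ∨ (3 * s + 1 ≤ d ∧ d + 2 ≤ 4 * s) ∨ (4 * s ≤ d ∧ d < 6 * s) ∨
      6 * s < d := by omega
  rcases cases with h | h | h | h | h | h | h | h | h | h
  · obtain ⟨c, hc⟩ : ∃ c, c = 2 * s + 1 := ⟨2 * s + 1, by omega⟩
    refine ⟨c, by omega, by omega, ?_⟩
    split_ifs <;> omega
  · obtain ⟨c, hc⟩ : ∃ c, c = 1 := ⟨1, by omega⟩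
    refine ⟨c, by omega, by omega, ?_⟩
    split_ifs <;> omega
  · obtain ⟨c, hc⟩ : ∃ c, c + 1 = 2 * s := ⟨2 * s - 1, by omega⟩
    refine ⟨c, by omega, by omega, ?_⟩
    split_ifs <;> omega
  · obtain ⟨c, hc⟩ : ∃ c, c + 1 = 4 * s := ⟨4 * s - 1, by omega⟩
    refine ⟨c, by omega, by omega, ?_⟩
    split_ifs <;> omega
  · obtain ⟨c, hc⟩ : ∃ c, c + 2 * d + 1 = 4 * s := ⟨4 * s - 1 - 2 * d, by omega⟩
    refine ⟨c, by omega, by omega, ?_⟩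
    split_ifs <;> omega
  · obtain ⟨c, hc⟩ : ∃ c, c + 2 * d = 4 * s + 1 := ⟨4 * s + 1 - 2 * d, by omega⟩
    refine ⟨c, by omega, by omega, ?_⟩
    split_ifs <;> omega
  · obtain ⟨c, hc⟩ : ∃ c, c + 4 * s + 1 = 2 * d := ⟨2 * d - (4 * s + 1), by omega⟩
    refine ⟨c, by omega, by omega, ?_⟩
    split_ifs <;> omega
  · obtain ⟨c, hc⟩ : ∃ c, c + 4 * s = 2 * d + 1 := ⟨2 * d - (4 * s - 1), by omega⟩
    refine ⟨c, by omega, by omega, ?_⟩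
    split_ifs <;> omega
  · obtain ⟨c, hc⟩ : ∃ c, c + 2 * d = 12 * s := ⟨12 * s - 2 * d, by omega⟩
    refine ⟨c, by omega, by omega, ?_⟩
    split_ifs <;> omega
  · obtain ⟨c, hc⟩ : ∃ c, c + 12 * s = 2 * d := ⟨2 * d - 12 * s, by omega⟩
    refine ⟨c, by omega, by omega, ?_⟩
    split_ifs <;> omega

theorem isSkolem_one {s : ℕ} (hs : 3 ≤ s) : IsSkolem (4 * s + 1) 0 fun b =>
    if b % 2 = 0 then 6 * s + 2 - b / 2 else if b = 1 then s + 1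
      else if b + 1 = 2 * s then 2 * s + 2 else if b = 4 * s + 1 then 2 * s + 1
      else if b < 2 * s then s + 2 + (2 * s - 1 - b) / 2 else (4 * s + 1 - b) / 2 := by
  refine ⟨?_, ?_, ?_, ?_, fun d hd hd' => ?_⟩
  iterate 4
    intro b hb hb'
    split_ifs <;> omega
  have cases :
    (d = s + 1 ∨ d = s + 2) ∨ (d = 2 * s + 2 ∨ d = 4 * s + 1) ∨ (d = 2 * s + 1 ∨ d = 6 * s + 2) ∨
      d ≤ s ∨ (s + 3 ≤ d ∧ d ≤ 2 * s) ∨ (2 * s + 3 ≤ d ∧ d ≤ 3 * s) ∨ (3 * s < d ∧ d ≤ 4 * s) ∨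
      (4 * s + 2 ≤ d ∧ d < 6 * s + 2) ∨ 6 * s + 3 ≤ d := by omega
  rcases cases with h | h | h | h | h | h | h | h | h
  · obtain ⟨c, hc⟩ : ∃ c, c = 1 := ⟨1, by omega⟩
    refine ⟨c, by omega, by omega, ?_⟩
    split_ifs <;> omega
  · obtain ⟨c, hc⟩ : ∃ c, c + 1 = 2 * s := ⟨2 * s - 1, by omega⟩
    refine ⟨c, by omega, by omega, ?_⟩
    split_ifs <;> omega
  · obtain ⟨c, hc⟩ : ∃ c, c = 4 * s + 1 := ⟨4 * s + 1, by omega⟩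
    refine ⟨c, by omega, by omega, ?_⟩
    split_ifs <;> omega
  · obtain ⟨c, hc⟩ : ∃ c, c + 2 * d = 4 * s + 1 := ⟨4 * s + 1 - 2 * d, by omega⟩
    refine ⟨c, by omega, by omega, ?_⟩
    split_ifs <;> omega
  · obtain ⟨c, hc⟩ : ∃ c, c + 2 * d = 4 * s + 3 := ⟨4 * s + 3 - 2 * d, by omega⟩
    refine ⟨c, by omega, by omega, ?_⟩
    split_ifs <;> omega
  · obtain ⟨c, hc⟩ : ∃ c, c + 4 * s + 3 = 2 * d := ⟨2 * d - (4 * s + 3), by omega⟩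
    refine ⟨c, by omega, by omega, ?_⟩
    split_ifs <;> omega
  · obtain ⟨c, hc⟩ : ∃ c, c + 4 * s + 1 = 2 * d := ⟨2 * d - (4 * s + 1), by omega⟩
    refine ⟨c, by omega, by omega, ?_⟩
    split_ifs <;> omega
  · obtain ⟨c, hc⟩ : ∃ c, c + 2 * d = 12 * s + 4 := ⟨12 * s + 4 - 2 * d, by omega⟩
    refine ⟨c, by omega, by omega, ?_⟩
    split_ifs <;> omega
  · obtain ⟨c, hc⟩ : ∃ c, c + 12 * s + 4 = 2 * d := ⟨2 * d - (12 * s + 4), by omega⟩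
    refine ⟨c, by omega, by omega, ?_⟩
    split_ifs <;> omega

theorem isSkolem_two {s : ℕ} (hs : 3 ≤ s) : IsSkolem (4 * s + 2) 1 fun b =>
    if b = 4 * s + 2 then 4 * s + 3 else if b % 2 = 0 then (4 * s + 2 - b) / 2
      else if b = 1 then 7 * s + 3 else if b = 2 * s + 1 then 4 * s + 2
      else if b = 4 * s + 1 then 2 * s + 1
      else if b < 2 * s then 5 * s + 2 + (2 * s + 1 - b) / 2
      else 4 * s + 3 + (4 * s + 1 - b) / 2 := by
  refine ⟨?_, ?_, ?_, ?_, fun d hd hd' => ?_⟩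
  iterate 4
    intro b hb hb'
    split_ifs <;> omega
  have cases :
    (d = 4 * s + 3 ∨ d = 8 * s + 5) ∨ (d = 7 * s + 3 ∨ d = 7 * s + 4) ∨
      (d = 4 * s + 2 ∨ d = 6 * s + 3) ∨ (d = 2 * s + 1 ∨ d = 6 * s + 2) ∨ d ≤ 2 * s ∨
      (2 * s + 2 ≤ d ∧ d ≤ 4 * s + 1) ∨ (4 * s + 4 ≤ d ∧ d ≤ 5 * s + 2) ∨
      (5 * s + 3 ≤ d ∧ d < 6 * s + 2) ∨ (6 * s + 4 ≤ d ∧ d ≤ 7 * s + 2) ∨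
      (7 * s + 5 ≤ d ∧ d < 8 * s + 4) := by omega
  rcases cases with h | h | h | h | h | h | h | h | h | h
  · obtain ⟨c, hc⟩ : ∃ c, c = 4 * s + 2 := ⟨4 * s + 2, by omega⟩
    refine ⟨c, by omega, by omega, ?_⟩
    split_ifs <;> omega
  · obtain ⟨c, hc⟩ : ∃ c, c = 1 := ⟨1, by omega⟩
    refine ⟨c, by omega, by omega, ?_⟩
    split_ifs <;> omega
  · obtain ⟨c, hc⟩ : ∃ c, c = 2 * s + 1 := ⟨2 * s + 1, by omega⟩
    refine ⟨c, by omega, by omega, ?_⟩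
    split_ifs <;> omega
  · obtain ⟨c, hc⟩ : ∃ c, c = 4 * s + 1 := ⟨4 * s + 1, by omega⟩
    refine ⟨c, by omega, by omega, ?_⟩
    split_ifs <;> omega
  · obtain ⟨c, hc⟩ : ∃ c, c + 2 * d = 4 * s + 2 := ⟨4 * s + 2 - 2 * d, by omega⟩
    refine ⟨c, by omega, by omega, ?_⟩
    split_ifs <;> omega
  · obtain ⟨c, hc⟩ : ∃ c, c + 4 * s + 2 = 2 * d := ⟨2 * d - (4 * s + 2), by omega⟩
    refine ⟨c, by omega, by omega, ?_⟩
    split_ifs <;> omega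
  · obtain ⟨c, hc⟩ : ∃ c, c + 2 * d = 12 * s + 7 := ⟨12 * s + 7 - 2 * d, by omega⟩
    refine ⟨c, by omega, by omega, ?_⟩
    split_ifs <;> omega
  · obtain ⟨c, hc⟩ : ∃ c, c + 2 * d = 12 * s + 5 := ⟨12 * s + 5 - 2 * d, by omega⟩
    refine ⟨c, by omega, by omega, ?_⟩
    split_ifs <;> omega
  · obtain ⟨c, hc⟩ : ∃ c, c + 12 * s + 5 = 2 * d := ⟨2 * d - (12 * s + 5), by omega⟩
    refine ⟨c, by omega, by omega, ?_⟩
    split_ifs <;> omega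
  · obtain ⟨c, hc⟩ : ∃ c, c + 12 * s + 7 = 2 * d := ⟨2 * d - (12 * s + 7), by omega⟩
    refine ⟨c, by omega, by omega, ?_⟩
    split_ifs <;> omega

theorem isSkolem_three {s : ℕ} (hs : 3 ≤ s) : IsSkolem (4 * s - 1) 1 fun b =>
    if b + 1 = 4 * s then 4 * s else if b + 2 = 4 * s then 2 * s + 1
      else if b % 2 = 0 then 4 * s + (4 * s - 2 - b) / 2
      else if b = 1 then s else if b + 1 = 2 * s then 2 * s else if b = 2 * s + 1 then s - 1
      else if b < 2 * s then s + 1 + (2 * s - 1 - b) / 2 else (4 * s - 1 - b) / 2 := by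
  refine ⟨?_, ?_, ?_, ?_, fun d hd hd' => ?_⟩
  iterate 4
    intro b hb hb'
    split_ifs <;> omega
  have cases :
    (d = 4 * s ∨ d = 8 * s - 1) ∨ (d = 2 * s + 1 ∨ d = 6 * s - 1) ∨ (d = s ∨ d = s + 1) ∨
      (d = 2 * s ∨ d = 4 * s - 1) ∨ (d = s - 1 ∨ d = 3 * s) ∨ d + 2 ≤ s ∨
      (s + 2 ≤ d ∧ d < 2 * s) ∨ (2 * s + 2 ≤ d ∧ d < 3 * s) ∨ (3 * s + 1 ≤ d ∧ d + 2 ≤ 4 * s) ∨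
      (4 * s + 1 ≤ d ∧ d + 2 ≤ 6 * s) ∨ (6 * s ≤ d ∧ d + 3 ≤ 8 * s) := by omega
  rcases cases with h | h | h | h | h | h | h | h | h | h | h
  · obtain ⟨c, hc⟩ : ∃ c, c + 1 = 4 * s := ⟨4 * s - 1, by omega⟩
    refine ⟨c, by omega, by omega, ?_⟩
    split_ifs <;> omega
  · obtain ⟨c, hc⟩ : ∃ c, c + 2 = 4 * s := ⟨4 * s - 2, by omega⟩
    refine ⟨c, by omega, by omega, ?_⟩
    split_ifs <;> omega
  · obtain ⟨c, hc⟩ : ∃ c, c = 1 := ⟨1, by omega⟩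
    refine ⟨c, by omega, by omega, ?_⟩
    split_ifs <;> omega
  · obtain ⟨c, hc⟩ : ∃ c, c + 1 = 2 * s := ⟨2 * s - 1, by omega⟩
    refine ⟨c, by omega, by omega, ?_⟩
    split_ifs <;> omega
  · obtain ⟨c, hc⟩ : ∃ c, c = 2 * s + 1 := ⟨2 * s + 1, by omega⟩
    refine ⟨c, by omega, by omega, ?_⟩
    split_ifs <;> omega
  · obtain ⟨c, hc⟩ : ∃ c, c + 2 * d + 1 = 4 * s := ⟨4 * s - 1 - 2 * d, by omega⟩
    refine ⟨c, by omega, by omega, ?_⟩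
    split_ifs <;> omega
  · obtain ⟨c, hc⟩ : ∃ c, c + 2 * d = 4 * s + 1 := ⟨4 * s + 1 - 2 * d, by omega⟩
    refine ⟨c, by omega, by omega, ?_⟩
    split_ifs <;> omega
  · obtain ⟨c, hc⟩ : ∃ c, c + 4 * s + 1 = 2 * d := ⟨2 * d - (4 * s + 1), by omega⟩
    refine ⟨c, by omega, by omega, ?_⟩
    split_ifs <;> omega
  · obtain ⟨c, hc⟩ : ∃ c, c + 4 * s = 2 * d + 1 := ⟨2 * d - (4 * s - 1), by omega⟩
    refine ⟨c, by omega, by omega, ?_⟩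
    split_ifs <;> omega
  · obtain ⟨c, hc⟩ : ∃ c, c + 2 * d + 2 = 12 * s := ⟨12 * s - 2 - 2 * d, by omega⟩
    refine ⟨c, by omega, by omega, ?_⟩
    split_ifs <;> omega
  · obtain ⟨c, hc⟩ : ∃ c, c + 12 * s = 2 * d + 2 := ⟨2 * d - (12 * s - 2), by omega⟩
    refine ⟨c, by omega, by omega, ?_⟩
    split_ifs <;> omega

theorem exists_isSkolem {n : ℕ} (hn : 14 ≤ n) : ∃ h D, h ≤ 1 ∧ IsSkolem n h D := by
  obtain h | h | h | h : n % 4 = 0 ∨ n % 4 = 1 ∨ n % 4 = 2 ∨ n % 4 = 3 := by omega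
  · obtain ⟨s, rfl⟩ : ∃ s, n = 4 * s := ⟨n / 4, by omega⟩
    exact ⟨0, _, by omega, isSkolem_zero (by omega)⟩
  · obtain ⟨s, rfl⟩ : ∃ s, n = 4 * s + 1 := ⟨n / 4, by omega⟩
    exact ⟨0, _, by omega, isSkolem_one (by omega)⟩
  · obtain ⟨s, rfl⟩ : ∃ s, n = 4 * s + 2 := ⟨n / 4, by omega⟩
    exact ⟨1, _, by omega, isSkolem_two (by omega)⟩
  · obtain ⟨s, rfl⟩ : ∃ s, n = 4 * s - 1 := ⟨(n + 1) / 4, by omega⟩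
    exact ⟨1, _, by omega, isSkolem_three (by omega)⟩

/-- `d` is, up to sign, a difference along the first `k` steps of the walk `c`. -/
def HasDiff {R : Type*} [AddCommGroup R] (k : ℕ) (c : ℕ → R) (d : R) : Prop :=
  ∃ m < k, c (m + 1) - c m = d ∨ c m - c (m + 1) = d

/-- Two zigzags joined by the path `-2 * J, H, L, L + A`, followed by `T`. -/
def zigzag (J : ℕ) (Y w H L A : ℤ) (T : ℕ → ℤ) (m : ℕ) : ℤ :=
  if m ≤ 2 * J then (if m % 2 = 0 then -(m : ℤ) else Y + m - 1)
  else if m = 2 * J + 1 then H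
  else if m = 2 * J + 2 then L
  else if m ≤ 4 * J + 3 then
    (if m % 2 = 1 then L + A + m - (2 * J + 3) else L + A - Y - m + (2 * J + 6) - w)
  else T (m - (4 * J + 4))

section zigzag

variable {J : ℕ} {Y w H L A : ℤ} {T : ℕ → ℤ}

theorem zigzag_tail (j : ℕ) : zigzag J Y w H L A T (4 * J + 4 + j) = T j := by
  unfold zigzag
  rw [if_neg (by omega), if_neg (by omega), if_neg (by omega), if_neg (by omega)]
  congr 1
  omega

theorem zigzag_of_le {m : ℕ} (hm : m ≤ 2 * J) : zigzag J Y w H L A T m =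
    if m % 2 = 0 then -(m : ℤ) else Y + m - 1 := by
  rw [zigzag, if_pos hm]

theorem zigzag_of_mem {m : ℕ} (hm : 2 * J + 3 ≤ m) (hm' : m ≤ 4 * J + 3) :
    zigzag J Y w H L A T m =
      if m % 2 = 1 then L + A + m - (2 * J + 3) else L + A - Y - m + (2 * J + 6) - w := by
  rw [zigzag, if_neg (by omega), if_neg (by omega), if_neg (by omega), if_pos hm']

theorem zigzag_two_mul : zigzag J Y w H L A T (2 * J) = -(2 * J) := by
  rw [zigzag_of_le le_rfl, if_pos (by omega)]
  push_cast
  rfl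

theorem zigzag_two_mul_add_one : zigzag J Y w H L A T (2 * J + 1) = H := by
  rw [zigzag, if_neg (by omega), if_pos rfl]

theorem zigzag_two_mul_add_two : zigzag J Y w H L A T (2 * J + 2) = L := by
  rw [zigzag, if_neg (by omega), if_neg (by omega), if_pos rfl]

theorem zigzag_two_mul_add_three : zigzag J Y w H L A T (2 * J + 3) = L + A := by
  rw [zigzag_of_mem le_rfl (by omega), if_pos (by omega)]
  push_cast
  ring

theorem zigzag_four_mul_add_three : zigzag J Y w H L A T (4 * J + 3) = L + A + 2 * J := by
  rw [zigzag_of_mem (by omega) le_rfl, if_pos (by omega)]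
  push_cast
  ring

/-- The ordinary differences of a zigzag. -/
theorem hasDiff_zigzag {l t : ℕ} (ht : t < J) {r : ℤ}
    (hr : r = 0 ∨ r = 2 ∨ r = w - 2 ∨ r = w) :
    HasDiff (4 * J + 4 + l) (zigzag J Y w H L A T) (Y + 4 * t + r) := by
  rcases hr with rfl | rfl | rfl | rfl
  · refine ⟨2 * t, by omega, .inl ?_⟩
    rw [zigzag_of_le (by omega), zigzag_of_le (by omega), if_neg (by omega), if_pos (by omega)]
    push_cast
    ring
  · refine ⟨2 * t + 1, by omega, .inr ?_⟩
    rw [zigzag_of_le (by omega), zigzag_of_le (by omega), if_neg (by omega), if_pos (by omega)]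
    push_cast
    ring
  · refine ⟨2 * J + 3 + 2 * t, by omega, .inr ?_⟩
    rw [zigzag_of_mem (by omega) (by omega), zigzag_of_mem (by omega) (by omega),
      if_pos (by omega), if_neg (by omega)]
    push_cast
    ring
  · refine ⟨2 * J + 3 + (2 * t + 1), by omega, .inl ?_⟩
    rw [zigzag_of_mem (by omega) (by omega), zigzag_of_mem (by omega) (by omega),
      if_pos (by omega), if_neg (by omega)]
    push_cast
    ring

theorem hasDiff_zigzag_first {l : ℕ} :
    HasDiff (4 * J + 4 + l) (zigzag J Y w H L A T) (H + 2 * J) :=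
  ⟨2 * J, by omega, .inl (by rw [zigzag_two_mul_add_one, zigzag_two_mul]; ring)⟩

theorem hasDiff_zigzag_second {l : ℕ} :
    HasDiff (4 * J + 4 + l) (zigzag J Y w H L A T) (H - L) :=
  ⟨2 * J + 1, by omega, .inr (by rw [zigzag_two_mul_add_one, zigzag_two_mul_add_two])⟩

theorem hasDiff_zigzag_third {l : ℕ} :
    HasDiff (4 * J + 4 + l) (zigzag J Y w H L A T) A :=
  ⟨2 * J + 2, by omega, .inl (by rw [zigzag_two_mul_add_three, zigzag_two_mul_add_two]; ring)⟩

theorem hasDiff_zigzag_joint {l : ℕ} (hl : 0 < l) :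
    HasDiff (4 * J + 4 + l) (zigzag J Y w H L A T) (L + A + 2 * J - T 0) :=
  ⟨4 * J + 3, by omega, .inr (by rw [zigzag_four_mul_add_three, zigzag_tail 0])⟩

theorem hasDiff_zigzag_tail {l j i : ℕ} (hj : j < l) (hi : j + 1 = i) {d : ℤ}
    (hd : T i - T j = d ∨ T j - T i = d) :
    HasDiff (4 * J + 4 + l) (zigzag J Y w H L A T) d := by
  subst hi
  refine ⟨4 * J + 4 + j, by omega, ?_⟩
  rwa [add_assoc (4 * J + 4) j 1, zigzag_tail, zigzag_tail]

theorem extended_zigzag {l m : ℕ} (hm : m < 4 * J + 4 + l + 2) {y : ℤ}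
    (hy : extended (4 * J + 4 + l) (2 * J + 2) (4 * J + 4) (zigzag J Y w H L A T) m = y) :
    (m ≤ 2 * J ∧ m % 2 = 0 ∧ y = -m) ∨ (m < 2 * J ∧ m % 2 = 1 ∧ y = Y + m - 1) ∨
    (m = 2 * J + 1 ∧ y = H) ∨ (m = 2 * J + 2 ∧ y = L) ∨
    (2 * J + 3 ≤ m ∧ m ≤ 4 * J + 3 ∧ m % 2 = 1 ∧ y = L + A + m - (2 * J + 3)) ∨
    (2 * J + 3 < m ∧ m < 4 * J + 3 ∧ m % 2 = 0 ∧ y = L + A - Y - m + (2 * J + 6) - w) ∨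
    (∃ j < l, m = 4 * J + 4 + j ∧ y = T j) ∨ (m = 4 * J + 4 + l ∧ y = H + A) ∨
    (m = 4 * J + 4 + l + 1 ∧ y = L + A + 2 * J + T 1 - T 0) := by
  unfold extended at hy
  by_cases h1 : m = 4 * J + 4 + l
  · rw [if_pos h1, reflected, show 2 * J + 2 - 1 = 2 * J + 1 by omega,
      show 2 * J + 2 + 1 = 2 * J + 3 by omega, zigzag_two_mul_add_one, zigzag_two_mul_add_two,
      zigzag_two_mul_add_three] at hy
    iterate 7 right
    exact .inl ⟨h1, by rw [← hy]; ring⟩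
  by_cases h2 : m = 4 * J + 4 + l + 1
  · rw [if_neg h1, if_pos h2, reflected, show 4 * J + 4 - 1 = 4 * J + 3 by omega,
      zigzag_four_mul_add_three, zigzag_tail 1, ← add_zero (4 * J + 4), zigzag_tail 0] at hy
    iterate 8 right
    exact ⟨h2, hy.symm⟩
  rw [if_neg h1, if_neg h2] at hy
  by_cases h3 : 4 * J + 4 ≤ m
  · obtain ⟨j, rfl⟩ := Nat.exists_eq_add_of_le h3
    rw [zigzag_tail] at hy
    iterate 6 right
    exact .inl ⟨j, by omega, rfl, hy.symm⟩
  by_cases h4 : m ≤ 2 * J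
  · rw [zigzag_of_le h4] at hy
    split_ifs at hy with h5
    · exact .inl ⟨h4, h5, hy.symm⟩
    · exact .inr (.inl ⟨by omega, by omega, hy.symm⟩)
  by_cases h5 : m = 2 * J + 1
  · rw [h5, zigzag_two_mul_add_one] at hy
    exact .inr (.inr (.inl ⟨h5, hy.symm⟩))
  by_cases h6 : m = 2 * J + 2
  · rw [h6, zigzag_two_mul_add_two] at hy
    exact .inr (.inr (.inr (.inl ⟨h6, hy.symm⟩)))
  rw [zigzag_of_mem (by omega) (by omega)] at hy
  iterate 4 right
  split_ifs at hy with h7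
  · exact .inl ⟨by omega, by omega, h7, hy.symm⟩
  · exact .inr (.inl ⟨by omega, by omega, by omega, hy.symm⟩)

theorem extended_zigzag_of_lt {l m : ℕ} (hm : m < 4 * J + 4 + l + 2) (hm' : 4 * J + 3 < m) {y : ℤ}
    (hy : extended (4 * J + 4 + l) (2 * J + 2) (4 * J + 4) (zigzag J Y w H L A T) m = y) :
    (∃ j < l, m = 4 * J + 4 + j ∧ y = T j) ∨ (m = 4 * J + 4 + l ∧ y = H + A) ∨
    (m = 4 * J + 4 + l + 1 ∧ y = L + A + 2 * J + T 1 - T 0) := by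
  obtain h | h | h | h | h | h | h := extended_zigzag hm hy
  iterate 6 omega
  exact h

end zigzag

/-- Integer walks that give the members of a switchable family. -/
structure IsRow (n k p q : ℕ) (c : ℕ → ℤ) : Prop where
  closed : c k = c 0
  ne : ∀ a b, a < b → b < k + 2 → extended k p q c a ≠ extended k p q c b
  sub_lt : ∀ a b, a < k + 2 → b < k + 2 →
    extended k p q c a - extended k p q c b < 2 * n * k + 1

theorem extended_of_lt {R : Type*} [AddCommGroup R] {k p q m : ℕ} {c : ℕ → R} (hm : m < k) :
    extended k p q c m = c m := by
  rw [extended, if_neg (by omega), if_neg (by omega)]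

theorem zigzag_ne {J : ℕ} {Y w H A e : ℤ} {T : ℕ → ℤ} (he : 0 < e) (hAe : (A + e) % 2 = 1)
    (hA : e < A) (hAY : A < Y) (hw : 3 ≤ w) (hw' : w % 2 = 1) (hH : Y + 2 * J ≤ H + 1)
    {a b : ℕ} (hab : a < b) (hb : b ≤ 4 * J + 3) :
    zigzag J Y w H (-2 * J - e) A T a ≠ zigzag J Y w H (-2 * J - e) A T b := by
  intro heq
  generalize hy : zigzag J Y w H (-2 * J - e) A T b = y at heq
  have ext : ∀ m ≤ 4 * J + 3, extended (4 * J + 4 + 0) (2 * J + 2) (4 * J + 4)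
      (zigzag J Y w H (-2 * J - e) A T) m = zigzag J Y w H (-2 * J - e) A T m :=
    fun m hm => extended_of_lt (by omega)
  rw [← ext a (by omega)] at heq
  rw [← ext b hb] at hy
  clear ext
  obtain ha' | ha' | ha' | ha' | ha' | ha' | ⟨j, hj, ha'⟩ | ha' | ha' :=
      extended_zigzag (by omega) heq <;>
    obtain hb' | hb' | hb' | hb' | hb' | hb' | ⟨j', hj', hb'⟩ | hb' | hb' :=
      extended_zigzag (by omega) hy <;>
    clear heq hy <;> omega

set_option maxHeartbeats 1000000 in
/-- Rows for cycles of length `3` modulo `4`. -/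
theorem exists_isRow_three {n J : ℕ} {h A c Y x : ℤ} (hh : h = 0 ∨ h = 1) (hA : 4 ≤ A)
    (hAc : A < c) (hAY : A < Y) (hcY : c ≤ Y + 1) (hcY' : c ≠ Y) (hx : Y + 4 * J ≤ x)
    (hcx : J = 0 → c ≠ x) (hV : x + 3 + h ≤ n * (4 * J + 4 + 3 : ℕ)) :
    ∃ r, IsRow n (4 * J + 4 + 3) (2 * J + 2) (4 * J + 4) r ∧
      HasDiff (4 * J + 4 + 3) r A ∧ HasDiff (4 * J + 4 + 3) r c ∧
      HasDiff (4 * J + 4 + 3) r (c - A) ∧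
      ∀ ρ, ρ = 0 ∨ ρ = 2 ∨ ρ = 1 + 2 * h ∨ ρ = 3 + 2 * h →
        (∀ t < J, HasDiff (4 * J + 4 + 3) r (Y + 4 * t + ρ)) ∧
          HasDiff (4 * J + 4 + 3) r (x + ρ) := by
  obtain ⟨e, he⟩ : ∃ e : ℤ, A % 2 = 1 ∧ e = 2 ∨ A % 2 = 0 ∧ e = 1 + 2 * h := by
    rcases Int.emod_two_eq_zero_or_one A with h | h
    · exact ⟨_, .inr ⟨h, rfl⟩⟩
    · exact ⟨_, .inl ⟨h, rfl⟩⟩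
  obtain ⟨T, hT0, hT1, hT2, hT3⟩ : ∃ T : ℕ → ℤ, T 0 = A - x - 3 - 2 * h ∧ T 1 = A ∧ T 2 = c ∧
      T 3 = 0 := ⟨fun j => [A - x - 3 - 2 * h, A, c].getD j 0, rfl, rfl, rfl, rfl⟩
  have bd : ∀ m < 4 * J + 4 + 3 + 2, ∀ y, extended (4 * J + 4 + 3) (2 * J + 2) (4 * J + 4)
      (zigzag J Y (3 + 2 * h) (x - 2 * J) (-2 * J - e) A T) m = y →
      A - x - 3 - 2 * h ≤ y ∧ y ≤ A - e + x + 3 + 2 * h := by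
    intro m hm y hy
    obtain hm | hm | hm | hm | hm | hm | ⟨j, hj, hm⟩ | hm | hm := extended_zigzag hm hy
    case inr.inr.inr.inr.inr.inr.inl => interval_cases j <;> omega
    all_goals omega
  refine ⟨zigzag J Y (3 + 2 * h) (x - 2 * J) (-2 * J - e) A T, ⟨?_, ?_, ?_⟩,
    hasDiff_zigzag_third, ?_, ?_, fun ρ hρ => ⟨fun t ht => hasDiff_zigzag ht ?_, ?_⟩⟩
  · rw [zigzag_tail, zigzag_of_le (by omega), hT3]
    simp
  · intro a b hab hb heq
    by_cases hb' : b ≤ 4 * J + 3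
    · rw [extended_of_lt (by omega), extended_of_lt (by omega)] at heq
      exact zigzag_ne (by omega) (by omega) (by omega) hAY (by omega) (by omega) (by omega)
        hab hb' heq
    generalize hy : extended (4 * J + 4 + 3) (2 * J + 2) (4 * J + 4)
      (zigzag J Y (3 + 2 * h) (x - 2 * J) (-2 * J - e) A T) b = y at heq
    obtain ha' | ha' | ha' | ha' | ha' | ha' | ⟨j, hj, ha'⟩ | ha' | ha' :=
        extended_zigzag (hab.trans hb) heq <;>
      obtain ⟨j', hj', hb'⟩ | hb' | hb' := extended_zigzag_of_lt hb (by omega) hy <;>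
      clear heq hy bd <;> try interval_cases j
    all_goals try interval_cases j'
    all_goals omega
  · intro a b ha hb
    have h1 := bd a ha _ rfl
    have h2 := bd b hb _ rfl
    rw [mul_assoc]
    omega
  · exact hasDiff_zigzag_tail (j := 2) (i := 3) (by omega) rfl (.inr (by omega))
  · exact hasDiff_zigzag_tail (j := 1) (i := 2) (by omega) rfl (.inl (by omega))
  · omega
  · have h1 := hasDiff_zigzag_first (J := J) (Y := Y) (w := 3 + 2 * h) (H := x - 2 * J)
      (L := -2 * J - e) (A := A) (T := T) (l := 3)
    have h2 := hasDiff_zigzag_second (J := J) (Y := Y) (w := 3 + 2 * h) (H := x - 2 * J)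
      (L := -2 * J - e) (A := A) (T := T) (l := 3)
    have h3 := hasDiff_zigzag_joint (J := J) (Y := Y) (w := 3 + 2 * h) (H := x - 2 * J)
      (L := -2 * J - e) (A := A) (T := T) (l := 3) (by omega)
    have h4 : HasDiff (4 * J + 4 + 3)
        (zigzag J Y (3 + 2 * h) (x - 2 * J) (-2 * J - e) A T) (x + 3 + 2 * h) :=
      hasDiff_zigzag_tail (j := 0) (i := 1) (by omega) rfl (.inl (by omega))
    obtain hd | hd | hd | hd : x + ρ = x - 2 * J + 2 * J ∨ x + ρ = x - 2 * J - (-2 * J - e) ∨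
        x + ρ = -2 * J - e + A + 2 * J - T 0 ∨ x + ρ = x + 3 + 2 * h := by omega
    all_goals rw [hd]; assumption

set_option maxHeartbeats 2000000 in
/-- Rows for cycles of length `1` modulo `4`. -/
theorem exists_isRow_one {n J : ℕ} {h A c Y x e s y : ℤ} (hh : 0 ≤ h) (hA : 9 ≤ A)
    (hAc : A < c) (hAY : A < Y) (hcY : c ≤ Y + 1) (hcY' : c ≠ Y)
    (he : A % 2 = 1 ∧ e = 2 ∨ A % 2 = 0 ∧ e = 1) (hx : Y + 4 * J ≤ x) (hcx : J = 0 → c ≠ x)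
    (hs : Y + 4 * J + 2 * h ≤ s) (hy : 0 < J → Y + 4 * J + 2 * h + 2 * e < y + 4)
    (hyY : Y + e ≤ y + 1) (hsy : s + 2 * e ≠ y + 3) (hsx : s - 3 + e ≠ x - 2 * J) (hxs : x ≤ s + 4)
    (h1 : s + x + e ≤ 2 * (n * (4 * J + 4 + 5 : ℕ)))
    (h2 : x + y + 3 ≤ 2 * (n * (4 * J + 4 + 5 : ℕ)) + e)
    (h3 : 2 * s + 2 * e ≤ 2 * (n * (4 * J + 4 + 5 : ℕ)) + 3)
    (h4 : s + y ≤ 2 * (n * (4 * J + 4 + 5 : ℕ))) :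
    ∃ r, IsRow n (4 * J + 4 + 5) (2 * J + 2) (4 * J + 4) r ∧
      HasDiff (4 * J + 4 + 5) r A ∧ HasDiff (4 * J + 4 + 5) r c ∧
      HasDiff (4 * J + 4 + 5) r (c - A) ∧
      (∀ t < J, ∀ ρ, ρ = 0 ∨ ρ = 2 ∨ ρ = 1 + 2 * h ∨ ρ = 3 + 2 * h →
        HasDiff (4 * J + 4 + 5) r (Y + 4 * t + ρ)) ∧
      ∀ z, z = x ∨ z = x + e ∨ z = s ∨ z = s + 2 * e - 3 ∨ z = y ∨ z = y + 3 - e →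
        HasDiff (4 * J + 4 + 5) r z := by
  obtain ⟨T, hT0, hT1, hT2, hT3, hT4, hT5⟩ : ∃ T : ℕ → ℤ, T 0 = A - e - s ∧ T 1 = A - 3 + e ∧
      T 2 = A - 3 + e - y ∧ T 3 = A ∧ T 4 = c ∧ T 5 = 0 :=
    ⟨fun j => [A - e - s, A - 3 + e, A - 3 + e - y, A, c].getD j 0, rfl, rfl, rfl, rfl, rfl, rfl⟩
  generalize hN : (n : ℤ) * (4 * J + 4 + 5 : ℕ) = N at *
  have bd : ∀ m < 4 * J + 4 + 5 + 2, ∀ z, extended (4 * J + 4 + 5) (2 * J + 2) (4 * J + 4)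
      (zigzag J Y (3 + 2 * h) (x - 2 * J) (-2 * J - e) A T) m = z →
      (A - e - s ≤ z ∨ A - 3 + e - y ≤ z) ∧ (z ≤ A + x - 2 * J ∨ z ≤ A - 3 + e + s) := by
    intro m hm z hz
    obtain hm | hm | hm | hm | hm | hm | ⟨j, hj, hm⟩ | hm | hm := extended_zigzag hm hz
    case inr.inr.inr.inr.inr.inr.inl =>
      interval_cases j <;> constructor <;> rcases he with ⟨he, rfl⟩ | ⟨he, rfl⟩ <;> omega
    all_goals constructor <;> rcases he with ⟨he, rfl⟩ | ⟨he, rfl⟩ <;> omega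
  refine ⟨zigzag J Y (3 + 2 * h) (x - 2 * J) (-2 * J - e) A T, ⟨?_, ?_, ?_⟩,
    hasDiff_zigzag_third, ?_, ?_, fun t ht ρ hρ => hasDiff_zigzag ht ?_, fun z hz => ?_⟩
  · rw [zigzag_tail, zigzag_of_le (by omega), hT5]
    simp
  · clear bd h1 h2 h3 h4
    intro a b hab hb heq
    by_cases hb' : b ≤ 4 * J + 3
    · rw [extended_of_lt (by omega), extended_of_lt (by omega)] at heq
      exact zigzag_ne (by omega) (by omega) (by omega) hAY (by omega) (by omega) (by omega)
        hab hb' heq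
    generalize hz : extended (4 * J + 4 + 5) (2 * J + 2) (4 * J + 4)
      (zigzag J Y (3 + 2 * h) (x - 2 * J) (-2 * J - e) A T) b = z at heq
    obtain ha' | ha' | ha' | ha' | ha' | ha' | ⟨j, hj, ha'⟩ | ha' | ha' :=
        extended_zigzag (hab.trans hb) heq <;>
      obtain ⟨j', hj', hb'⟩ | hb' | hb' := extended_zigzag_of_lt hb (by omega) hz <;>
      clear heq hz <;> try interval_cases j
    all_goals try interval_cases j'
    all_goals omega
  · intro a b ha hb
    have h5 := bd a ha _ rfl
    have h6 := bd b hb _ rfl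
    rw [mul_assoc, hN]
    omega
  · exact hasDiff_zigzag_tail (j := 4) (i := 5) (by omega) rfl (.inr (by omega))
  · exact hasDiff_zigzag_tail (j := 3) (i := 4) (by omega) rfl (.inl (by omega))
  · omega
  · have h5 := hasDiff_zigzag_first (J := J) (Y := Y) (w := 3 + 2 * h) (H := x - 2 * J)
      (L := -2 * J - e) (A := A) (T := T) (l := 5)
    have h6 := hasDiff_zigzag_second (J := J) (Y := Y) (w := 3 + 2 * h) (H := x - 2 * J)
      (L := -2 * J - e) (A := A) (T := T) (l := 5)
    have h7 := hasDiff_zigzag_joint (J := J) (Y := Y) (w := 3 + 2 * h) (H := x - 2 * J)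
      (L := -2 * J - e) (A := A) (T := T) (l := 5) (by omega)
    rcases hz with hz | hz | hz | hz | hz | hz
    · convert h5 using 1
      omega
    · convert h6 using 1
      omega
    · convert h7 using 1
      omega
    · exact hasDiff_zigzag_tail (j := 0) (i := 1) (by omega) rfl (.inl (by omega))
    · exact hasDiff_zigzag_tail (j := 1) (i := 2) (by omega) rfl (.inr (by omega))
    · exact hasDiff_zigzag_tail (j := 2) (i := 3) (by omega) rfl (.inl (by omega))

/-- A row containing the differences prescribed by a Skolem sequence and the quadruples
numbered `J * i, …, J * i + J - 1`. -/
structure IsBaseRow (n k J h i : ℕ) (D : ℕ → ℕ) (r : ℕ → ℤ) : Prop where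
  row : IsRow n k (2 * J + 2) (4 * J + 4) r
  left : HasDiff k r (n + D (i + 1))
  right : HasDiff k r (n + (D (i + 1) + (i + 1)))
  width : HasDiff k r (i + 1)
  quad : ∀ t < J, ∀ ρ : ℤ, ρ = 0 ∨ ρ = 2 ∨ ρ = 1 + 2 * h ∨ ρ = 3 + 2 * h →
    HasDiff k r (3 * n + 1 - h + 4 * (J * i + t) + ρ)

namespace IsSkolem

variable {n h J i : ℕ} {D : ℕ → ℕ}

theorem exists_isBaseRow_three (hD : IsSkolem n h D) (hh : h ≤ 1) (hn : 9 ≤ n) (hi : i < n) :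
    ∃ r, IsBaseRow n (4 * J + 4 + 3) J h i D r ∧
      ∀ ρ : ℤ, ρ = 0 ∨ ρ = 2 ∨ ρ = 1 + 2 * h ∨ ρ = 3 + 2 * h →
        HasDiff (4 * J + 4 + 3) r (3 * n + 1 - h + 4 * (n * J + i) + ρ) := by
  have h1 := hD.pos (i + 1) (by omega) hi
  have h2 := hD.add_le (i + 1) (by omega) hi
  have h3 := hD.ne (i + 1) (by omega) hi
  have h4 := hD.add_ne (i + 1) (by omega) hi
  generalize hb : D (i + 1) = b at *
  have hJi : (J : ℤ) * i + J ≤ n * J := by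
    have := Nat.mul_le_mul_left J hi
    push_cast [← Nat.cast_le (α := ℤ)] at this
    linarith
  have hJi' : 0 ≤ (J : ℤ) * i := by positivity
  have hJ0 : J = 0 → (n : ℤ) * J = 0 := by
    rintro rfl
    simp
  have hnk : (n : ℤ) * (4 * J + 4 + 3 : ℕ) = 4 * (n * J) + 7 * n := by
    push_cast
    ring
  generalize hY : (J : ℤ) * i = Y at *
  generalize hM : (n : ℤ) * J = M at *
  obtain ⟨r, hr, hA, hc, hw, hq⟩ := exists_isRow_three (n := n) (J := J) (h := h)
    (A := n + b) (c := n + (b + (i + 1))) (Y := 3 * n + 1 - h + 4 * Y)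
    (x := 3 * n + 1 - h + 4 * (M + i)) (by omega) (by omega) (by omega) (by omega) (by omega)
    (by omega) (by omega) (by omega) (by omega)
  refine ⟨r, ⟨hr, ?_, ?_, ?_, ?_⟩, fun ρ hρ => (hq ρ hρ).2⟩
  · rwa [hb]
  · rwa [hb]
  · convert hw using 1
    ring
  · intro t ht ρ hρ
    convert (hq ρ hρ).1 t ht using 1
    rw [hY]
    ring

theorem exists_isBaseRow_one (hD : IsSkolem n h D) (hh : h ≤ 1) (hn : 9 ≤ n) (hi : i < n)
    {u p q : ℕ} (hu : 3 * n + 4 * (n * J) + 1 ≤ u + h)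
    (hu' : h = 1 → u ≠ 3 * n + 4 * (n * J) + 1)
    (hui : h = 1 → i + 1 = n → u ≠ 3 * n + 4 * (n * J))
    (hp : 3 * n + 4 * (n * J) + 1 + 2 * h ≤ p) (hpq : p + 2 ≤ q)
    (hup : u + 2 ≤ p ∨ p % 2 = u % 2) (hup' : u ≤ p + 4) (hqu : q ≠ u)
    (hq : q + 1 ≤ 9 * n + 4 * (n * J)) (hu3 : u + 1 ≤ 9 * n + 4 * (n * J)) :
    ∃ r, IsBaseRow n (4 * J + 4 + 5) J h i D r ∧
      ∀ z : ℕ, z = u ∨ z = u + 2 ∨ z = p ∨ z = p + 1 ∨ z = q ∨ z = q + 1 →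
        HasDiff (4 * J + 4 + 5) r z := by
  have h1 := hD.pos (i + 1) (by omega) hi
  have h2 := hD.add_le (i + 1) (by omega) hi
  have h3 := hD.ne (i + 1) (by omega) hi
  have h4 := hD.add_ne (i + 1) (by omega) hi
  generalize hb : D (i + 1) = b at *
  have hJi : J * i + J ≤ n * J := by
    have := Nat.mul_le_mul_left J hi
    linarith
  have hJi' : i + 1 ≠ n → J * i + 2 * J ≤ n * J := by
    intro hin
    have : J * (i + 2) ≤ J * n := Nat.mul_le_mul_left J (by omega)
    linarith
  have hJ0 : J = 0 → n * J = 0 := by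
    rintro rfl
    simp
  have hnk : (n : ℤ) * (4 * J + 4 + 5 : ℕ) = 4 * (n * J : ℕ) + 9 * n := by
    push_cast
    ring
  have hY : (J : ℤ) * i = (J * i : ℕ) := by push_cast; rfl
  generalize J * i = Y at *
  generalize n * J = M at *
  suffices ∃ r, IsRow n (4 * J + 4 + 5) (2 * J + 2) (4 * J + 4) r ∧
      HasDiff (4 * J + 4 + 5) r (n + b : ℤ) ∧ HasDiff (4 * J + 4 + 5) r (n + (b + (i + 1)) : ℤ) ∧
      HasDiff (4 * J + 4 + 5) r (n + (b + (i + 1)) - (n + b) : ℤ) ∧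
      (∀ t < J, ∀ ρ : ℤ, ρ = 0 ∨ ρ = 2 ∨ ρ = 1 + 2 * h ∨ ρ = 3 + 2 * h →
        HasDiff (4 * J + 4 + 5) r (3 * n + 1 - h + 4 * Y + 4 * t + ρ)) ∧
      ∀ z : ℕ, z = u ∨ z = u + 2 ∨ z = p ∨ z = p + 1 ∨ z = q ∨ z = q + 1 →
        HasDiff (4 * J + 4 + 5) r z by
    obtain ⟨r, hr, hA, hc, hw, hq, hz⟩ := this
    refine ⟨r, ⟨hr, ?_, ?_, ?_, ?_⟩, hz⟩
    · rwa [hb]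
    · rwa [hb]
    · convert hw using 1
      ring
    · intro t ht ρ hρ
      convert hq t ht ρ hρ using 1
      rw [hY]
      ring
  rcases Nat.mod_two_eq_zero_or_one (n + b) with hA | hA
  · obtain ⟨r, hr, hA, hc, hw, hq, hz⟩ := exists_isRow_one (n := n) (J := J) (h := h)
      (A := n + b) (c := n + (b + (i + 1))) (Y := 3 * n + 1 - h + 4 * Y)
      (x := p) (e := 1) (s := q + 1) (y := u) (by omega) (by omega) (by omega) (by omega)
      (by omega) (by omega) (by omega) (by omega) (by omega) (by omega) (by omega) (by omega)
      (by omega) (by omega) (by omega) (by omega) (by omega) (by omega) (by omega)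
    exact ⟨r, hr, hA, hc, hw, hq, fun z h => hz z (by omega)⟩
  · obtain ⟨r, hr, hA, hc, hw, hq, hz⟩ := exists_isRow_one (n := n) (J := J) (h := h)
      (A := n + b) (c := n + (b + (i + 1))) (Y := 3 * n + 1 - h + 4 * Y)
      (x := u) (e := 2) (s := p) (y := q) (by omega) (by omega) (by omega) (by omega)
      (by omega) (by omega) (by omega) (by omega) (by omega) (by omega) (by omega) (by omega)
      (by omega) (by omega) (by omega) (by omega) (by omega) (by omega) (by omega)
    exact ⟨r, hr, hA, hc, hw, hq, fun z h => hz z (by omega)⟩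

end IsSkolem

theorem exists_block {n h N d : ℕ} (hh : h ≤ 1) (hd : 3 * n + 1 ≤ d + h)
    (hd' : h = 1 → d ≠ 3 * n + 1) (hN : d ≤ 3 * n + 4 * N + h) (hN' : h = 1 → d ≠ 3 * n + 4 * N) :
    ∃ j < N, ∃ ρ : ℕ, (ρ = 0 ∨ ρ = 2 ∨ ρ = 1 + 2 * h ∨ ρ = 3 + 2 * h) ∧
      d + h = 3 * n + 1 + 4 * j + ρ := by
  obtain rfl | rfl : h = 0 ∨ h = 1 := by omega
  · exact ⟨(d - (3 * n + 1)) / 4, by omega, (d - (3 * n + 1)) % 4, by omega, by omega⟩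
  · obtain h | h | h | h : (d - 3 * n) % 4 = 0 ∨ (d - 3 * n) % 4 = 1 ∨ (d - 3 * n) % 4 = 2 ∨
        (d - 3 * n) % 4 = 3 := by omega
    · exact ⟨(d - 3 * n) / 4, by omega, 0, by omega, by omega⟩
    · exact ⟨(d - 3 * n) / 4 - 1, by omega, 5, by omega, by omega⟩
    · exact ⟨(d - 3 * n) / 4, by omega, 2, by omega, by omega⟩
    · exact ⟨(d - 3 * n) / 4, by omega, 3, by omega, by omega⟩

section rows

variable {n k J h p q : ℕ} {D : ℕ → ℕ} {r : Fin n → ℕ → ℤ}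

theorem IsSkolem.exists_hasDiff_low (hD : IsSkolem n h D)
    (hr : ∀ i : Fin n, IsBaseRow n k J h i D (r i)) {d : ℕ} (hd : 1 ≤ d)
    (hd' : d < 3 * n ∨ d = 3 * n + h) : ∃ i, HasDiff k (r i) d := by
  by_cases hdn : d ≤ n
  · refine ⟨⟨d - 1, by omega⟩, ?_⟩
    convert (hr ⟨d - 1, by omega⟩).width using 1
    simp only
    omega
  · obtain ⟨b, hb, hbn, h⟩ := hD.cover (d - n) (by omega) (by omega)
    obtain ⟨b, rfl⟩ : ∃ b', b = b' + 1 := ⟨b - 1, by omega⟩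
    refine ⟨⟨b, hbn⟩, ?_⟩
    rcases h with h | h
    · convert (hr ⟨b, hbn⟩).left using 1
      simp only
      omega
    · convert (hr ⟨b, hbn⟩).right using 1
      simp only
      omega

theorem exists_hasDiff_quad (hr : ∀ i : Fin n, IsBaseRow n k J h i D (r i)) {j : ℕ}
    (hj : j < n * J) {ρ : ℤ} (hρ : ρ = 0 ∨ ρ = 2 ∨ ρ = 1 + 2 * h ∨ ρ = 3 + 2 * h) :
    ∃ i, HasDiff k (r i) (3 * n + 1 - h + 4 * j + ρ) := by
  have hi : j / J < n := Nat.div_lt_of_lt_mul (by rwa [mul_comm] at hj)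
  have hJ : 0 < J := Nat.pos_of_ne_zero (by rintro rfl; simp at hj)
  refine ⟨⟨j / J, hi⟩, ?_⟩
  convert (hr ⟨j / J, hi⟩).quad (j % J) (Nat.mod_lt _ hJ) ρ hρ using 3
  have := Nat.div_add_mod j J
  push_cast [← Nat.cast_inj (R := ℤ)] at this ⊢
  rw [this]

theorem isSwitchable_cast (hp : 2 ≤ p) (hpq : p + 2 ≤ q) (hq : q + 1 < k)
    (hr : ∀ i, IsRow n k p q (r i))
    (hcov : ∀ d : ℕ, 1 ≤ d → d ≤ n * k →
      ∃ i, HasDiff k (r i) d ∨ d = n * k ∧ HasDiff k (r i) (d + 1 : ℕ)) :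
    IsSwitchable n k p q fun i m => ((r i m : ℤ) : ZMod (2 * n * k + 1)) := by
  have ext : ∀ i m, extended k p q (fun m => ((r i m : ℤ) : ZMod (2 * n * k + 1))) m =
      (extended k p q (r i) m : ℤ) := by
    intro i m
    unfold extended reflected
    split_ifs <;> push_cast <;> rfl
  have cast : ∀ i, ∀ d : ℤ, HasDiff k (r i) d → ∀ x : ZMod (2 * n * k + 1),
      x = (d : ZMod (2 * n * k + 1)) ∨ x = -(d : ZMod (2 * n * k + 1)) →
      ∃ m < k, (r i (m + 1) : ZMod (2 * n * k + 1)) - r i m = x ∨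
        (r i m : ZMod (2 * n * k + 1)) - r i (m + 1) = x := by
    rintro i d ⟨m, hm, hd⟩ x hx
    refine ⟨m, hm, ?_⟩
    rcases hd with rfl | rfl <;> rcases hx with rfl | rfl <;> push_cast <;> simp
  refine ⟨hp, hpq, hq, fun i => ?_, fun i a ha b hb hab => ?_, fun x hx => ?_⟩
  · rw [(hr i).closed]
  · rw [ext, ext, ZMod.intCast_eq_intCast_iff_dvd_sub] at hab
    have h1 := (hr i).sub_lt a b ha hb
    have h2 := (hr i).sub_lt b a hb ha
    have h3 := Int.eq_zero_of_abs_lt_dvd hab (by push_cast; rw [abs_lt]; constructor <;> linarith)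
    rcases lt_trichotomy a b with h | h | h
    · exact absurd (by linarith) ((hr i).ne a b h hb)
    · exact h
    · exact absurd (by linarith) ((hr i).ne b a h ha)
  · have hle := ZMod.natAbs_valMinAbs_le x
    have hle' : x.valMinAbs.natAbs ≤ n * k := by
      refine hle.trans ?_
      rw [mul_assoc]
      omega
    have hpos : 1 ≤ x.valMinAbs.natAbs :=
      Nat.one_le_iff_ne_zero.2 (by simpa using hx)
    have hx' : x = ((x.valMinAbs.natAbs : ℤ) : ZMod (2 * n * k + 1)) ∨
        x = -((x.valMinAbs.natAbs : ℤ) : ZMod (2 * n * k + 1)) := by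
      rcases Int.natAbs_eq x.valMinAbs with h | h
      · left
        rw [← h, ZMod.coe_valMinAbs]
      · right
        rw [← Int.cast_neg, ← h, ZMod.coe_valMinAbs]
    obtain ⟨i, h | ⟨h, h'⟩⟩ := hcov _ hpos hle'
    · exact ⟨i, cast i _ h x hx'⟩
    · refine ⟨i, cast i _ h' x ?_⟩
      have hneg : (((x.valMinAbs.natAbs + 1 : ℕ) : ℤ) : ZMod (2 * n * k + 1)) =
          -((x.valMinAbs.natAbs : ℤ) : ZMod (2 * n * k + 1)) := by
        have := ZMod.natCast_self (2 * n * k + 1)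
        rw [h]
        push_cast at this ⊢
        linear_combination this
      rw [hneg, neg_neg]
      exact hx'.symm

end rows

variable {n : ℕ}

theorem exists_isSwitchable_three (hn : 14 ≤ n) (J : ℕ) :
    ∃ p q c, IsSwitchable (v := 2 * n * (4 * J + 4 + 3) + 1) n (4 * J + 4 + 3) p q c := by
  obtain ⟨h, D, hh, hD⟩ := exists_isSkolem hn
  have := fun i : Fin n => hD.exists_isBaseRow_three (J := J) hh (by omega) i.2
  choose r hr hr' using this
  refine ⟨_, _, _, isSwitchable_cast (by omega) (by omega) (by omega)
    (fun i => (hr i).row) fun d hd hdn => ?_⟩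
  have hnk : n * (4 * J + 4 + 3) = 3 * n + 4 * (n * J + n) := by ring
  have high : ∀ d : ℕ, 3 * n + 1 ≤ d + h → (h = 1 → d ≠ 3 * n + 1) →
      d ≤ 3 * n + 4 * (n * J + n) + h → (h = 1 → d ≠ 3 * n + 4 * (n * J + n)) →
      ∃ i, HasDiff (4 * J + 4 + 3) (r i) d := by
    intro d h1 h2 h3 h4
    obtain ⟨j, hj, ρ, hρ, hd⟩ := exists_block hh h1 h2 h3 h4
    have hd' : (d : ℤ) = 3 * n + 1 - h + 4 * j + ρ := by omega
    by_cases hjn : j < n * J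
    · rw [hd']
      exact exists_hasDiff_quad hr hjn (by omega)
    · refine ⟨⟨j - n * J, by omega⟩, ?_⟩
      convert hr' ⟨j - n * J, by omega⟩ ρ (by omega) using 1
      push_cast [Nat.cast_sub (not_lt.1 hjn)]
      linarith
  by_cases hlow : d < 3 * n ∨ d = 3 * n + h
  · obtain ⟨i, hi⟩ := hD.exists_hasDiff_low hr hd hlow
    exact ⟨i, .inl hi⟩
  by_cases htop : h = 1 ∧ d = 3 * n + 4 * (n * J + n)
  · obtain ⟨i, hi⟩ := high (d + 1) (by omega) (by omega) (by omega) (by omega)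
    exact ⟨i, .inr ⟨by omega, hi⟩⟩
  · obtain ⟨i, hi⟩ := high d (by omega) (by omega) (by omega) (by omega)
    exact ⟨i, .inl hi⟩

/-- The starts `u`, `p`, `q` of the special differences `u, u + 2, p, p + 1, q, q + 1` of a row,
relative to the first special difference. -/
def specialStarts (n h i : ℕ) : ℕ × ℕ × ℕ :=
  if h = 1 then
    if i % 2 = 0 then (6 * i, 6 * i + 3, 6 * i + 5) else (6 * i + 5, 6 * i + 1, 6 * i + 3)
  else if i % 2 = 0 then
    if i + 1 = n then (6 * i + 5, 6 * i + 1, 6 * i + 3) else (6 * i + 1, 6 * i + 5, 6 * i + 7)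
  else (6 * i - 4, 6 * i + 3, 6 * i + 5)

theorem exists_specialStarts {h d : ℕ} (hh : h ≤ 1) (hd : 1 ≤ d + h) (hdn : d ≤ 6 * n)
    (hd' : h = 1 → d ≠ 1) (hn : 2 ≤ n) : ∃ i < n, ∃ z, (z = d ∨ d = 6 * n ∧ z = d + 1) ∧
      (z = (specialStarts n h i).1 ∨ z = (specialStarts n h i).1 + 2 ∨
        z = (specialStarts n h i).2.1 ∨ z = (specialStarts n h i).2.1 + 1 ∨
        z = (specialStarts n h i).2.2 ∨ z = (specialStarts n h i).2.2 + 1) := by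
  obtain rfl | rfl : h = 0 ∨ h = 1 := by omega
  · obtain ⟨g, s, hg, hs⟩ : ∃ g s, d = 12 * g + 1 + s ∧ s < 12 :=
      ⟨(d - 1) / 12, (d - 1) % 12, by omega, by omega⟩
    by_cases hlast : 2 * g + 1 = n
    · by_cases h5 : s = 5
      · refine ⟨2 * g, by omega, d + 1, .inr (by omega), ?_⟩
        simp only [specialStarts, zero_ne_one, if_false]
        split_ifs <;> dsimp only <;> omega
      · refine ⟨2 * g, by omega, d, .inl rfl, ?_⟩
        simp only [specialStarts, zero_ne_one, if_false]
        split_ifs <;> dsimp only <;> omega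
    · by_cases h5 : s = 0 ∨ s = 2 ∨ 4 ≤ s ∧ s ≤ 7
      · refine ⟨2 * g, by omega, d, .inl rfl, ?_⟩
        simp only [specialStarts, zero_ne_one, if_false]
        split_ifs <;> dsimp only <;> omega
      · refine ⟨2 * g + 1, by omega, d, .inl rfl, ?_⟩
        simp only [specialStarts, zero_ne_one, if_false]
        split_ifs <;> dsimp only <;> omega
  · obtain ⟨g, s, hg, hs⟩ : ∃ g s, d = 12 * g + s ∧ s < 12 :=
      ⟨d / 12, d % 12, by omega, by omega⟩
    simp only [specialStarts, if_true]
    by_cases htop : 2 * g = n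
    · refine ⟨2 * g - 1, by omega, d + 1, .inr (by omega), ?_⟩
      rw [if_neg (by omega)]
      dsimp only
      omega
    · by_cases h1 : s = 1
      · refine ⟨2 * g - 1, by omega, d, .inl rfl, ?_⟩
        rw [if_neg (by omega)]
        dsimp only
        omega
      by_cases h6 : s ≤ 6
      · refine ⟨2 * g, by omega, d, .inl rfl, ?_⟩
        rw [if_pos (by omega)]
        dsimp only
        omega
      · refine ⟨2 * g + 1, by omega, d, .inl rfl, ?_⟩
        rw [if_neg (by omega)]
        dsimp only
        omega

theorem exists_isSwitchable_one (hn : 14 ≤ n) (J : ℕ) :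
    ∃ p q c, IsSwitchable (v := 2 * n * (4 * J + 4 + 5) + 1) n (4 * J + 4 + 5) p q c := by
  obtain ⟨h, D, hh, hD⟩ := exists_isSkolem hn
  have : ∀ i : Fin n, ∃ r, IsBaseRow n (4 * J + 4 + 5) J h i D r ∧ ∀ z : ℕ,
      (z = (specialStarts n h i).1 ∨ z = (specialStarts n h i).1 + 2 ∨
        z = (specialStarts n h i).2.1 ∨ z = (specialStarts n h i).2.1 + 1 ∨
        z = (specialStarts n h i).2.2 ∨ z = (specialStarts n h i).2.2 + 1) →
      HasDiff (4 * J + 4 + 5) r (3 * n + 4 * (n * J) + z : ℕ) := by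
    intro i
    have hi := i.2
    have key := hD.exists_isBaseRow_one (J := J) hh (by omega) hi
      (u := 3 * n + 4 * (n * J) + (specialStarts n h i).1)
      (p := 3 * n + 4 * (n * J) + (specialStarts n h i).2.1)
      (q := 3 * n + 4 * (n * J) + (specialStarts n h i).2.2)
    obtain ⟨r, hr, hz⟩ := key (by unfold specialStarts; split_ifs <;> dsimp only <;> omega)
      (by unfold specialStarts; split_ifs <;> dsimp only <;> omega)
      (by unfold specialStarts; split_ifs <;> dsimp only <;> omega)
      (by unfold specialStarts; split_ifs <;> dsimp only <;> omega)
      (by unfold specialStarts; split_ifs <;> dsimp only <;> omega)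
      (by unfold specialStarts; split_ifs <;> dsimp only <;> omega)
      (by unfold specialStarts; split_ifs <;> dsimp only <;> omega)
      (by unfold specialStarts; split_ifs <;> dsimp only <;> omega)
      (by unfold specialStarts; split_ifs <;> dsimp only <;> omega)
      (by unfold specialStarts; split_ifs <;> dsimp only <;> omega)
    exact ⟨r, hr, fun z h => hz _ (by omega)⟩
  choose r hr hr' using this
  refine ⟨_, _, _, isSwitchable_cast (by omega) (by omega) (by omega)
    (fun i => (hr i).row) fun d hd hdn => ?_⟩
  have hnk : n * (4 * J + 4 + 5) = 3 * n + 4 * (n * J) + 6 * n := by ring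
  by_cases hlow : d < 3 * n ∨ d = 3 * n + h
  · obtain ⟨i, hi⟩ := hD.exists_hasDiff_low hr hd hlow
    exact ⟨i, .inl hi⟩
  by_cases hmid : d ≤ 3 * n + 4 * (n * J) + h ∧ (h = 1 → d ≠ 3 * n + 4 * (n * J))
  · obtain ⟨j, hj, ρ, hρ, hd⟩ := exists_block hh (by omega) (by omega) hmid.1 hmid.2
    have hd' : (d : ℤ) = 3 * n + 1 - h + 4 * j + ρ := by omega
    obtain ⟨i, hi⟩ := exists_hasDiff_quad hr hj (ρ := ρ) (by omega)
    exact ⟨i, .inl (hd' ▸ hi)⟩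
  · obtain ⟨s, rfl⟩ : ∃ s, d = 3 * n + 4 * (n * J) + s := ⟨d - (3 * n + 4 * (n * J)), by omega⟩
    obtain ⟨i, hi, z, hz, hzi⟩ := exists_specialStarts (n := n) (h := h) (d := s) hh
      (by omega) (by omega) (by omega) (by omega)
    refine ⟨⟨i, hi⟩, ?_⟩
    have := hr' ⟨i, hi⟩ z hzi
    rcases hz with rfl | ⟨hs, rfl⟩
    · exact .inl this
    · exact .inr ⟨by omega, this⟩

theorem two_mul_add_one_le_pow {n : ℕ} (hn : 7 ≤ n) : (2 * n + 1 : ℝ) ≤ 1.6 ^ n := by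
  induction n, hn using Nat.le_induction with
  | base => norm_num
  | succ n hn ih =>
    have : (7 : ℝ) ≤ n := by exact_mod_cast hn
    rw [pow_succ]
    push_cast
    linarith

theorem pow_div_le_of_four_pow_le {n k C : ℕ} (hn : 7 ≤ n) (hk : 0 < k)
    (h : 4 ^ n ≤ C * (2 * n * k + 1)) : (2.49 : ℝ) ^ n / k ≤ C := by
  have hk' : (1 : ℝ) ≤ k := by exact_mod_cast hk
  have h4 : (4 : ℝ) ^ n ≤ C * (2 * n * k + 1) := by exact_mod_cast h
  have hpos : (0 : ℝ) < 2 * n + 1 := by positivity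
  rw [div_le_iff₀ (by linarith)]
  refine le_of_mul_le_mul_right ?_ hpos
  calc (2.49 : ℝ) ^ n * (2 * n + 1) ≤ 2.49 ^ n * 1.6 ^ n := by
        gcongr
        exact two_mul_add_one_le_pow hn
    _ = (2.49 * 1.6) ^ n := (mul_pow _ _ _).symm
    _ ≤ 4 ^ n := by gcongr; norm_num
    _ ≤ C * (2 * n * k + 1) := h4
    _ ≤ C * k * (2 * n + 1) := by
        rw [mul_assoc _ (k : ℝ)]
        gcongr
        linarith

end CCS

/-- There is `N` such that for every odd `k > 5` and every `n ≥ N`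
not congruent to `4 (mod 7)`, `NC(2nk+1, k) ≥ 2.49^n / k`. -/
theorem stmt13 : ∃ N : ℕ, ∀ k n : ℕ, Odd k → 5 < k → N ≤ n → n % 7 ≠ 4 →
    (2.49 : ℝ) ^ n / (k : ℝ) ≤ (CCS.NC (2 * n * k + 1) k : ℝ) := by
  refine ⟨14, fun k n hk hk5 hn _ => CCS.pow_div_le_of_four_pow_le (by omega) (by omega) ?_⟩
  obtain ⟨m, rfl⟩ := hk
  obtain ⟨J, hJ | hJ⟩ : ∃ J, 2 * m + 1 = 4 * J + 4 + 3 ∨ 2 * m + 1 = 4 * J + 4 + 5 :=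
    ⟨(2 * m - 6) / 4, by omega⟩
  · rw [hJ]
    obtain ⟨p, q, c, h⟩ := CCS.exists_isSwitchable_three hn J
    exact h.four_pow_le
  · rw [hJ]
    obtain ⟨p, q, c, h⟩ := CCS.exists_isSwitchable_one hn J
    exact h.four_pow_le
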